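/- Let r = (r_j)_{j≥1} be a sequence with r_j ∈ (0,∞] and 0 < r := inf_j r_j < ∞. Define D(r) = {z = Σ_j p_j φ_j^+ + q_j φ_j^- ∈ Z : p_j² + q_j² < r_j² for all j} and E(r) = {z = Σ_j p_j φ_j^+ + q_j φ_j^- ∈ Z : Σ_j (p_j² + q_j²)/r_j² < 1}. Then c(E(r)) = c(D(r)) = π r², where c is Kuksin's symplectic capacity on Z. -/

import Mathlib

open scoped RealInnerProductSpace BigOperators ENNReal NNReal
open Metric

noncomputable section

namespace Kuksin

variable {Z : Type*} [NormedAddCommGroup Z] [InnerProductSpace ℝ Z] [CompleteSpace Z]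

/-- The family `b (j, true) = φ_j^+`, `b (j, false) = φ_j^-` (indexed by `j : ℕ`,
standing for `j ≥ 1`) is a Hilbert basis of `Z`. -/
def IsHilbertBasis (b : ℕ × Bool → Z) : Prop :=
  Orthonormal ℝ b ∧ (Submodule.span ℝ (Set.range b)).topologicalClosure = ⊤

/-- The operator `J` acts by `J φ_j^± = ∓ φ_j^∓`. -/
def IsJ (b : ℕ × Bool → Z) (J : Z →L[ℝ] Z) : Prop :=
  ∀ j : ℕ, J (b (j, true)) = - b (j, false) ∧ J (b (j, false)) = b (j, true)

/-- The orthogonal projector `Π^n` onto `Z^n = span {φ_j^± : j < n}`. -/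
def proj (b : ℕ × Bool → Z) (n : ℕ) (z : Z) : Z :=
  ∑ j ∈ Finset.range n, (⟪b (j, true), z⟫ • b (j, true) + ⟪b (j, false), z⟫ • b (j, false))

/-- A (global-in-time) trajectory of the Hamiltonian vector field `X_{f_n} = J ∇ f_n` of
`f_n = f|_{O ∩ Z^n}` on `O^n = O ∩ Z^n`  (the gradient of the restriction of `f` to `Z^n`
is `Π^n ∇f`). -/
def IsTrajectory (b : ℕ × Bool → Z) (J : Z →L[ℝ] Z) (O : Set Z) (f : Z → ℝ) (n : ℕ)
    (z : ℝ → Z) : Prop :=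
  (∀ t : ℝ, z t ∈ O) ∧ (∀ t : ℝ, proj b n (z t) = z t) ∧
  (∀ t : ℝ, HasDerivAt z (J (proj b n (gradient f (z t)))) t)

/-- A fast trajectory: a nonconstant periodic trajectory of period `≤ 1`. -/
def IsFastTrajectory (b : ℕ × Bool → Z) (J : Z →L[ℝ] Z) (O : Set Z) (f : Z → ℝ) (n : ℕ)
    (z : ℝ → Z) : Prop :=
  IsTrajectory b J O f n z ∧ (∃ t₁ t₂ : ℝ, z t₁ ≠ z t₂) ∧
  (∃ T : ℝ, 0 < T ∧ T ≤ 1 ∧ ∀ t : ℝ, z (t + T) = z t)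

/-- `f` is an `m`-admissible function on the open set `O`. -/
def IsAdmissible (O : Set Z) (m : ℝ) (f : Z → ℝ) : Prop :=
  0 < m ∧ ContDiffOn ℝ (⊤ : ℕ∞) f O ∧ (∀ z ∈ O, 0 ≤ f z ∧ f z ≤ m) ∧
  (∃ U : Set Z, IsOpen U ∧ U.Nonempty ∧ U ⊆ O ∧ ∀ z ∈ U, f z = 0) ∧
  (∀ z ∈ frontier O, f z = m) ∧
  Bornology.IsBounded {z ∈ O | f z < m} ∧
  (∃ d : ℝ, 0 < d ∧ ∀ x ∈ {z ∈ O | f z < m}, ∀ y ∈ frontier O, d ≤ dist x y)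

/-- An `m`-admissible function `f` is fast if for all large enough `n` the Hamiltonian
vector field `X_{f_n}` has a fast trajectory. -/
def IsFastFunction (b : ℕ × Bool → Z) (J : Z →L[ℝ] Z) (O : Set Z) (f : Z → ℝ) : Prop :=
  ∃ n₀ : ℕ, ∀ n ≥ n₀, ∃ z : ℝ → Z, IsFastTrajectory b J O f n z

/-- The set of thresholds `m*` such that every `m`-admissible function with `m > m*` is fast. -/
def capSet (b : ℕ × Bool → Z) (J : Z →L[ℝ] Z) (O : Set Z) : Set ℝ :=
  {m' | 0 ≤ m' ∧ ∀ m : ℝ, ∀ f : Z → ℝ, m' < m → IsAdmissible O m f → IsFastFunction b J O f}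

/-- Kuksin's symplectic capacity of an open set `O ⊆ Z` (with value in `[0, ∞]`). -/
def cap (b : ℕ × Bool → Z) (J : Z →L[ℝ] Z) (O : Set Z) : ℝ≥0∞ :=
  sInf (ENNReal.ofReal '' capSet b J O)


section Part1
lemma det_interp (d : ℕ) (t : ℕ → ℝ) (ht : Function.Injective t) :
    ∃ c : ℕ → ℝ, (∑ i ∈ Finset.range (d + 1), c i = 1) ∧
      ∀ {E : Type*} [AddCommGroup E] [Module ℝ E] [FiniteDimensional ℝ E], 
        Module.finrank ℝ E = d → ∀ A : E →ₗ[ℝ] E,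
        LinearMap.det A = ∑ i ∈ Finset.range (d + 1), c i *
          LinearMap.det ((1 - t i) • (LinearMap.id : E →ₗ[ℝ] E) + t i • A) := by
  classical
  have key : ∀ p : Polynomial ℝ, p.degree < (d + 1 : ℕ) →
      p.eval 1 = ∑ i ∈ Finset.range (d + 1),
        (Lagrange.basis (Finset.range (d+1)) t i).eval 1 * p.eval (t i) := by
    intro p hp
    have h := Lagrange.eq_interpolate (s := Finset.range (d+1)) (v := t) (f := p)
      (ht.injOn) (by simpa using hp)
    conv_lhs => rw [h]
    rw [Lagrange.interpolate_apply, Polynomial.eval_finsetSum]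
    simp [mul_comm]
  refine ⟨fun i => (Lagrange.basis (Finset.range (d+1)) t i).eval 1, ?_, ?_⟩
  · have := key 1 (by rw [Polynomial.degree_one]; exact_mod_cast Nat.succ_pos d)
    simpa using this.symm
  · intro E _ _ _ hE A
    let b := Module.finBasisOfFinrankEq ℝ E hE
    set M := LinearMap.toMatrix b b A with hM
    obtain ⟨p, hp⟩ : ∃ p : Polynomial ℝ, p = Matrix.det ((Polynomial.X : Polynomial ℝ) • (M - 1).map Polynomial.C
      + (1 : Matrix (Fin d) (Fin d) ℝ).map Polynomial.C) := ⟨_, rfl⟩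
    have hpd : p.degree < (d + 1 : ℕ) := by
      have h1 : p.natDegree ≤ Fintype.card (Fin d) := by
        rw [hp]
        exact Polynomial.natDegree_det_X_add_C_le (M - 1) (1 : Matrix (Fin d) (Fin d) ℝ)
      rw [Fintype.card_fin] at h1
      exact lt_of_le_of_lt Polynomial.degree_le_natDegree (by exact_mod_cast Nat.lt_succ_of_le h1)
    have hev : ∀ s : ℝ, p.eval s = LinearMap.det ((1 - s) • (LinearMap.id : E →ₗ[ℝ] E) + s • A) := by
      intro s
      rw [← LinearMap.det_toMatrix b]
      have : (LinearMap.toMatrix b b) ((1 - s) • (LinearMap.id : E →ₗ[ℝ] E) + s • A)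
          = s • (M - 1) + 1 := by
        rw [map_add, map_smul, map_smul, LinearMap.toMatrix_id, ← hM]
        module
      rw [this, hp]
      rw [← Polynomial.coe_evalRingHom, RingHom.map_det]
      congr 1
      ext i j
      by_cases hij : i = j
      · subst hij; simp [Matrix.map_apply]; try ring
      · simp [hij, Matrix.map_apply]; try ring
    have := key p hpd
    simp only [hev] at this
    simpa using this

lemma no_retract {E : Type*} [NormedAddCommGroup E] [InnerProductSpace ℝ E]
    [FiniteDimensional ℝ E] (R : ℝ) (hR : 0 < R) (H : E → E) (hH : ContDiff ℝ 1 H)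
    (hn : ∀ x, ‖H x‖ = R) (hid : ∀ x, ‖x‖ = R → H x = x) : False := by
  classical
  let _ : MeasurableSpace E := borel E
  have : BorelSpace E := ⟨rfl⟩
  let μ : MeasureTheory.Measure E := MeasureTheory.Measure.addHaar
  have hHd : Differentiable ℝ H := hH.differentiable (by norm_num)
  have hHc : Continuous (fderiv ℝ H) := hH.continuous_fderiv (by norm_num)
  set A := fderiv ℝ H with hA
  have hdet0 : ∀ x, (A x).det = 0 := by
    intro x
    by_contra hne
    have hort : ∀ v, ⟪H x, A x v⟫ = 0 := by
      intro v
      have h1 : HasFDerivAt (fun y => ‖H y‖ ^ 2) (2 • (innerSL ℝ (H x)).comp (A x)) x :=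
        (hHd x).hasFDerivAt.norm_sq
      have h2 : HasFDerivAt (fun y => ‖H y‖ ^ 2) (0 : E →L[ℝ] ℝ) x := by
        simp only [hn]; exact hasFDerivAt_const _ _
      have := congrArg (fun l : E →L[ℝ] ℝ => l v) (h1.unique h2)
      simpa using this
    have hsurj : Function.Surjective (A x) := by
      have hu : IsUnit (LinearMap.det (A x : E →ₗ[ℝ] E)) := isUnit_iff_ne_zero.mpr hne
      have := ((LinearMap.isUnit_iff_isUnit_det _).mpr hu)
      have := (Module.End.isUnit_iff _).mp this
      exact this.2
    obtain ⟨v, hv⟩ := hsurj (H x)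
    have := hort v
    rw [hv, real_inner_self_eq_norm_sq, hn] at this
    have := pow_pos hR 2
    linarith
  -- Lipschitz constant
  obtain ⟨C, hC⟩ := (isCompact_closedBall (0 : E) R).exists_bound_of_continuousOn hHc.continuousOn
  set L : ℝ := max C 0 with hL
  have hL0 : 0 ≤ L := le_max_right _ _
  have hAL : ∀ x ∈ closedBall (0 : E) R, ‖A x‖ ≤ L := fun x hx => (hC x hx).trans (le_max_left _ _)
  have hlip : ∀ x ∈ closedBall (0 : E) R, ∀ y ∈ closedBall (0 : E) R, ‖H x - H y‖ ≤ L * ‖x - y‖ := by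
    intro x hx y hy
    exact (convex_closedBall (0:E) R).norm_image_sub_le_of_norm_fderiv_le
      (fun z _ => hHd z) hAL hy hx
  set t0 : ℝ := 1 / (2 * (L + 1)) with ht0
  have ht0p : 0 < t0 := by positivity
  have ht0L : t0 * (L + 1) = 1 / 2 := by rw [ht0]; field_simp
  have ht0h : t0 ≤ 1/2 := by nlinarith
  let f : ℝ → E → E := fun t x => (1 - t) • x + t • H x
  let f' : ℝ → E → E →L[ℝ] E := fun t x => (1 - t) • ContinuousLinearMap.id ℝ E + t • A x
  have hf' : ∀ t x, HasStrictFDerivAt (f t) (f' t x) x := by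
    intro t x
    have h1 : HasStrictFDerivAt H (A x) x := hH.contDiffAt.hasStrictFDerivAt (by norm_num)
    exact ((hasStrictFDerivAt_id x).const_smul (1 - t)).add (h1.const_smul t)
  have hexp : ∀ t, 0 ≤ t → t ≤ t0 → ∀ x ∈ closedBall (0:E) R, ∀ v, ‖v‖ / 2 ≤ ‖f' t x v‖ := by
    intro t h0 h1 x hx v
    have e : f' t x v = v - (t • v - t • A x v) := by simp [f']; module
    have h2 : ‖t • v - t • A x v‖ ≤ t * ‖v‖ + t * (L * ‖v‖) := by
      refine (norm_sub_le _ _).trans ?_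
      rw [norm_smul, norm_smul, Real.norm_of_nonneg h0]
      have := (A x).le_of_opNorm_le (hAL x hx) v
      gcongr
    have h3 : ‖v‖ - ‖t • v - t • A x v‖ ≤ ‖f' t x v‖ := by rw [e]; exact norm_sub_norm_le _ _
    have h4 : t * (L+1) * ‖v‖ ≤ 1/2 * ‖v‖ := by
      rw [← ht0L]; gcongr
    nlinarith
  have hdetne : ∀ t, 0 ≤ t → t ≤ t0 → ∀ x ∈ closedBall (0:E) R, (f' t x).det ≠ 0 := by
    intro t h0 h1 x hx hd
    have hinj : Function.Injective (f' t x : E →ₗ[ℝ] E) := by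
      rw [← LinearMap.ker_eq_bot, LinearMap.ker_eq_bot']
      intro v hv
      have := hexp t h0 h1 x hx v
      have hv' : f' t x v = 0 := hv
      rw [hv', norm_zero] at this
      exact norm_le_zero_iff.mp (by linarith)
    have hu : IsUnit (f' t x : E →ₗ[ℝ] E) := by
      rw [Module.End.isUnit_iff]
      exact ⟨hinj, LinearMap.injective_iff_surjective.mp hinj⟩
    exact ((LinearMap.isUnit_iff_isUnit_det _).mp hu).ne_zero hd
  have hdetcont : ∀ x, Continuous (fun t => (f' t x).det) := by
    intro x
    exact ContinuousLinearMap.continuous_det.comp (by fun_prop)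
  have hdetpos : ∀ t, 0 ≤ t → t ≤ t0 → ∀ x ∈ closedBall (0:E) R, 0 < (f' t x).det := by
    intro t h0 h1 x hx
    by_contra hneg
    push Not at hneg
    have h10 : (f' 0 x).det = 1 := by
      simp only [f', sub_zero, one_smul, zero_smul, add_zero]
      exact LinearMap.det_id
    have := intermediate_value_Icc' h0 (hdetcont x).continuousOn
    have hmem : (0:ℝ) ∈ Set.Icc ((f' t x).det) ((f' 0 x).det) := ⟨hneg, by rw [h10]; norm_num⟩
    obtain ⟨s, hs, hs0⟩ := this hmem
    exact hdetne s hs.1 (hs.2.trans h1) x hx hs0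
  have hinj : ∀ t, 0 ≤ t → t ≤ t0 → Set.InjOn (f t) (closedBall (0:E) R) := by
    intro t h0 h1 x hx y hy hxy
    have e : x - y = t • (x - y) - t • (H x - H y) := by
      have : (1 - t) • x + t • H x = (1 - t) • y + t • H y := hxy
      have h2 : x - y - (t • (x - y) - t • (H x - H y)) = 
        ((1 - t) • x + t • H x) - ((1 - t) • y + t • H y) := by module
      rw [this, sub_self] at h2
      exact sub_eq_zero.mp h2
    have h2 : ‖x - y‖ ≤ t * ‖x - y‖ + t * (L * ‖x - y‖) := by
      conv_lhs => rw [e]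
      refine (norm_sub_le _ _).trans ?_
      rw [norm_smul, norm_smul, Real.norm_of_nonneg h0]
      have := hlip x hx y hy
      gcongr
    have h4 : t * (L+1) * ‖x - y‖ ≤ 1/2 * ‖x - y‖ := by
      rw [← ht0L]; gcongr
    have : ‖x - y‖ ≤ 0 := by nlinarith
    exact sub_eq_zero.mp (norm_le_zero_iff.mp this)
  have himg : ∀ t, 0 ≤ t → t ≤ t0 → f t '' (ball (0:E) R) = ball (0:E) R := by
    intro t h0 h1
    have hfc : Continuous (f t) := by
      have := hHd.continuous
      simp only [f]; fun_prop
    have hsub : f t '' (ball (0:E) R) ⊆ ball (0:E) R := by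
      rintro _ ⟨x, hx, rfl⟩
      rw [mem_ball_zero_iff] at hx ⊢
      calc ‖f t x‖ ≤ (1 - t) * ‖x‖ + t * ‖H x‖ := by
            refine (norm_add_le _ _).trans ?_
            rw [norm_smul, norm_smul, Real.norm_of_nonneg h0, Real.norm_of_nonneg (by linarith)]
        _ < R := by rw [hn]; nlinarith
    have hopen : IsOpen (f t '' (ball (0:E) R)) := by
      rw [isOpen_iff_mem_nhds]
      rintro _ ⟨x, hx, rfl⟩
      have hx' : x ∈ closedBall (0:E) R := ball_subset_closedBall hx
      have hu : IsUnit (f' t x : E →ₗ[ℝ] E) := (LinearMap.isUnit_iff_isUnit_det _).mpr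
        (isUnit_iff_ne_zero.mpr (hdetne t h0 h1 x hx'))
      have hs : Function.Surjective (f' t x) := ((Module.End.isUnit_iff _).mp hu).2
      have := (hf' t x).map_nhds_eq_of_surj (LinearMap.range_eq_top.mpr hs)
      rw [← this]
      exact Filter.image_mem_map (isOpen_ball.mem_nhds hx)
    have hpre : IsPreconnected (ball (0:E) R) := (convex_ball (0:E) R).isPreconnected
    have hcl : IsClosed (f t '' closedBall (0:E) R) :=
      ((isCompact_closedBall (0:E) R).image hfc).isClosed
    apply Set.Subset.antisymm hsub
    have hsplit : ball (0:E) R ⊆ f t '' (ball (0:E) R) ∪ (f t '' closedBall (0:E) R)ᶜ := by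
      intro y hy
      by_cases h : y ∈ f t '' closedBall (0:E) R
      · left
        obtain ⟨x, hx, rfl⟩ := h
        rw [mem_closedBall_zero_iff] at hx
        rcases hx.lt_or_eq with h | h
        · exact ⟨x, by simpa using h, rfl⟩
        · exfalso
          have : f t x = x := by simp only [f, hid x h]; module
          rw [this, mem_ball_zero_iff, h] at hy
          exact lt_irrefl _ hy
      · right; exact h
    refine hpre.subset_left_of_subset_union hopen hcl.isOpen_compl ?_ hsplit ?_
    · exact Set.disjoint_compl_right_iff_subset.mpr (Set.image_mono ball_subset_closedBall)
    · exact ⟨f t 0, hsub ⟨0, by simpa using hR, rfl⟩, ⟨0, by simpa using hR, rfl⟩⟩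
  have hvol : ∀ t, 0 ≤ t → t ≤ t0 → ∫ x in ball (0:E) R, (f' t x).det ∂μ = μ.real (ball (0:E) R) := by
    intro t h0 h1
    have h2 := MeasureTheory.integral_image_eq_integral_abs_det_fderiv_smul μ
      (measurableSet_ball (x := (0:E)) (ε := R))
      (fun x _ => (hf' t x).hasFDerivAt.hasFDerivWithinAt)
      ((hinj t h0 h1).mono ball_subset_closedBall) (fun _ => (1:ℝ))
    rw [himg t h0 h1] at h2
    simp only [smul_eq_mul, mul_one, MeasureTheory.integral_const, MeasureTheory.measureReal_restrict_apply_univ] at h2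
    rw [h2]
    refine MeasureTheory.setIntegral_congr_fun measurableSet_ball (fun x hx => ?_)
    exact (abs_of_pos (hdetpos t h0 h1 x (ball_subset_closedBall hx))).symm
  -- interpolation
  let t : ℕ → ℝ := fun i => t0 / (i + 1)
  have htinj : Function.Injective t := by
    intro i j hij
    have : t0 / ((i:ℝ) + 1) = t0 / ((j:ℝ) + 1) := hij
    rw [div_eq_div_iff (by positivity) (by positivity)] at this
    have := mul_left_cancel₀ ht0p.ne' this
    have : (j:ℝ) = i := by linarith
    exact_mod_cast this.symm
  have htr : ∀ i, 0 ≤ t i ∧ t i ≤ t0 := by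
    intro i
    refine ⟨by positivity, div_le_self ht0p.le (by linarith [(Nat.cast_nonneg i : (0:ℝ) ≤ i)])⟩
  obtain ⟨c, hc1, hc⟩ := det_interp (Module.finrank ℝ E) t htinj
  have hint : ∀ s, MeasureTheory.IntegrableOn (fun x => (f' s x).det) (ball (0:E) R) μ := by
    intro s
    have : Continuous (fun x => (f' s x).det) := 
      ContinuousLinearMap.continuous_det.comp (by fun_prop)
    exact (this.continuousOn.integrableOn_compact (isCompact_closedBall (0:E) R)).mono_set
      ball_subset_closedBall
  have hsum : ∀ x, (0:ℝ) = ∑ i ∈ Finset.range (Module.finrank ℝ E + 1), c i * (f' (t i) x).det := by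
    intro x
    rw [← hdet0 x]
    exact hc rfl (A x : E →ₗ[ℝ] E)
  have h0 : (0:ℝ) = ∫ x in ball (0:E) R, (0:ℝ) ∂μ := by simp
  have h1 : ∫ x in ball (0:E) R, (0:ℝ) ∂μ = μ.real (ball (0:E) R) := by
    calc ∫ x in ball (0:E) R, (0:ℝ) ∂μ 
        = ∫ x in ball (0:E) R, ∑ i ∈ Finset.range (Module.finrank ℝ E + 1), c i * (f' (t i) x).det ∂μ := by
          congr 1; ext x; exact hsum x
      _ = ∑ i ∈ Finset.range (Module.finrank ℝ E + 1), c i * ∫ x in ball (0:E) R, (f' (t i) x).det ∂μ := by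
          rw [MeasureTheory.integral_finsetSum _ (fun i _ => (hint (t i)).const_mul (c i))]
          simp_rw [MeasureTheory.integral_const_mul]
      _ = ∑ i ∈ Finset.range (Module.finrank ℝ E + 1), c i * μ.real (ball (0:E) R) := by
          refine Finset.sum_congr rfl (fun i _ => ?_)
          rw [hvol _ (htr i).1 (htr i).2]
      _ = μ.real (ball (0:E) R) := by rw [← Finset.sum_mul, hc1, one_mul]
  have hpos : 0 < μ.real (ball (0:E) R) := by
    rw [MeasureTheory.measureReal_def]
    exact ENNReal.toReal_pos (measure_ball_pos μ _ hR).ne' MeasureTheory.measure_ball_lt_top.ne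
  linarith

lemma surj_of_id_outside_aux {E : Type*} [NormedAddCommGroup E] [InnerProductSpace ℝ E]
    [FiniteDimensional ℝ E] (F : E → E) (hF : Continuous F) (R : ℝ)
    (hid : ∀ x, R ≤ ‖x‖ → F x = x) : ∃ x, F x = 0 := by
  by_contra hne
  push Not at hne
  set R' := max R 1
  have hR' : 0 < R' := lt_of_lt_of_le one_pos (le_max_right _ _)
  obtain ⟨g, hg, hgd, hgs⟩ := (hF.sub continuous_id).exists_contDiff_approx 1 (ε := fun x => ‖F x‖)
    hF.norm (fun x => norm_pos_iff.mpr (hne x))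
  have hG0 : ∀ x, x + g x ≠ 0 := by
    intro x h0
    have := hgd x
    rw [dist_eq_norm] at this
    have e : g x - (F - (id : E → E)) x = - F x := by
      have : g x = - x := by rw [eq_neg_iff_add_eq_zero, add_comm]; exact h0
      simp [this]; abel
    rw [e, norm_neg] at this
    exact lt_irrefl _ this
  refine no_retract R' hR' (fun x => (R' / ‖x + g x‖) • (x + g x)) ?_ ?_ ?_
  · have h1 : ContDiff ℝ 1 (fun x => x + g x) := contDiff_id.add hg
    exact (contDiff_const.div (h1.norm ℝ hG0) (fun x => norm_ne_zero_iff.mpr (hG0 x))).smul h1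
  · intro x
    rw [norm_smul, norm_div, norm_norm, Real.norm_of_nonneg hR'.le]
    exact div_mul_cancel₀ _ (norm_ne_zero_iff.mpr (hG0 x))
  · intro x hx
    have hgx : g x = 0 := by
      by_contra h
      have := hgs h
      apply this
      simp [hid x (hx ▸ le_max_left _ _)]
    simp only [hgx, add_zero, hx]
    rw [div_self hR'.ne', one_smul]

lemma surj_of_id_outside {E : Type*} [NormedAddCommGroup E] [NormedSpace ℝ E]
    [FiniteDimensional ℝ E] (F : E → E) (hF : Continuous F) (R : ℝ)
    (hid : ∀ x, R ≤ ‖x‖ → F x = x) (p : E) : ∃ x, F x = p := by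
  let T := toEuclidean (E := E)
  -- translate
  let G : EuclideanSpace ℝ (Fin (Module.finrank ℝ E)) → EuclideanSpace ℝ (Fin (Module.finrank ℝ E)) :=
    fun y => T (F (T.symm y + p) - p)
  have hG : Continuous G := by
    simp only [G]; fun_prop
  set TT : E →L[ℝ] EuclideanSpace ℝ (Fin (Module.finrank ℝ E)) := T.toContinuousLinearMap with hTT
  obtain ⟨y, hy⟩ := surj_of_id_outside_aux G hG ((‖TT‖ + 1) * (|R| + ‖p‖ + 1)) (by
    intro y hy
    have : F (T.symm y + p) = T.symm y + p := by
      apply hid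
      by_contra hT
      push Not at hT
      have h1 : ‖T.symm y‖ < |R| + ‖p‖ := by
        have := norm_sub_le (T.symm y + p) p
        rw [add_sub_cancel_right] at this
        linarith [le_abs_self R]
      have h2 : ‖y‖ ≤ ‖TT‖ * ‖T.symm y‖ := by
        have := TT.le_opNorm (T.symm y)
        simpa [hTT] using this
      have h3 : 0 ≤ ‖TT‖ := norm_nonneg _
      have h4 := norm_nonneg (T.symm y)
      nlinarith
    simp [G, this])
  refine ⟨T.symm y + p, ?_⟩
  have : F (T.symm y + p) - p = 0 := T.map_eq_zero_iff.mp hy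
  exact sub_eq_zero.mp this
end Part1

section Part2
lemma minimax {V : Type*} [NormedAddCommGroup V] [InnerProductSpace ℝ V] [FiniteDimensional ℝ V]
    (W : Submodule ℝ V) (e : V) (he : e ∈ Wᗮ) (hne : ‖e‖ = 1) (p : V) (hp : p ∈ W)
    (Φ : V → ℝ) (D : V → V) (hΦ : Continuous Φ) (hD : Continuous D) (C : ℝ) (hC : 0 < C)
    (hdesc : ∀ x h, Φ (x + h) ≤ Φ x + ⟪D x, h⟫ + C * ‖h‖ ^ 2)
    (c C' : ℝ) (hc : 0 < c) (hPS : ∀ x, c * ‖x‖ - C' ≤ ‖D x‖)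
    (hW : ∀ w ∈ W, Φ w ≤ 0) (R : ℝ)
    (hinf : ∀ w ∈ W, ∀ s : ℝ, 0 ≤ s → R ≤ ‖w + s • e‖ → Φ (w + s • e) ≤ 0)
    (α β : ℝ) (hα : 0 < α) (hβ : 0 < β)
    (hΓ : ∀ y ∈ Wᗮ, ‖y‖ = α → β ≤ Φ (p + y)) :
    ∃ x, D x = 0 ∧ β ≤ Φ x := by
  by_contra hno
  push Not at hno
  -- gradient lower bound
  obtain ⟨δ, hδ, hδD⟩ : ∃ δ > 0, ∀ x, β ≤ Φ x → δ ≤ ‖D x‖ := by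
    set R1 := (1 + C') / c
    have hcomp : IsCompact (closedBall (0:V) R1 ∩ {x | β ≤ Φ x}) :=
      (isCompact_closedBall _ _).inter_right (isClosed_le continuous_const hΦ)
    have hout : ∀ x, x ∉ closedBall (0:V) R1 → 1 ≤ ‖D x‖ := by
      intro x hx
      rw [mem_closedBall_zero_iff, not_le, div_lt_iff₀ hc] at hx
      linarith [hPS x]
    by_cases hne : (closedBall (0:V) R1 ∩ {x | β ≤ Φ x}).Nonempty
    · obtain ⟨x0, hx0, hmin⟩ := hcomp.exists_isMinOn hne hD.norm.continuousOn
      have hx0' : 0 < ‖D x0‖ := by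
        rw [norm_pos_iff]
        intro h
        exact absurd hx0.2 (not_le.mpr (hno x0 h))
      refine ⟨min 1 ‖D x0‖, lt_min one_pos hx0', fun x hx => ?_⟩
      by_cases hb : x ∈ closedBall (0:V) R1
      · exact (min_le_right _ _).trans (hmin ⟨hb, hx⟩)
      · exact (min_le_left _ _).trans (hout x hb)
    · refine ⟨1, one_pos, fun x hx => hout x (fun hb => hne ⟨x, hb, hx⟩)⟩
  obtain ⟨M, hM⟩ : ∃ M : ℝ, ∀ w ∈ W, ∀ s : ℝ, 0 ≤ s → Φ (w + s • e) ≤ M := by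
    obtain ⟨M, hM⟩ := ((isCompact_closedBall (0:V) R).image hΦ).bddAbove
    refine ⟨max M 0, fun w hw s hs => ?_⟩
    by_cases h : R ≤ ‖w + s • e‖
    · exact (hinf w hw s hs h).trans (le_max_right _ _)
    · refine le_trans (hM ⟨_, ?_, rfl⟩) (le_max_left _ _)
      rw [mem_closedBall_zero_iff]; exact (not_le.mp h).le
  let χ : V → ℝ := fun x => min 1 (max 0 (Φ x / β))
  have hχc : Continuous χ := by simp only [χ]; fun_prop
  have hχ0 : ∀ x, 0 ≤ χ x := fun x => le_min zero_le_one (le_max_left _ _)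
  have hχ1 : ∀ x, χ x ≤ 1 := fun x => min_le_left _ _
  have hχz : ∀ x, Φ x ≤ 0 → χ x = 0 := by
    intro x hx
    have : Φ x / β ≤ 0 := div_nonpos_of_nonpos_of_nonneg hx hβ.le
    simp [χ, max_eq_left this]
  have hχo : ∀ x, β ≤ Φ x → χ x = 1 := by
    intro x hx
    have : 1 ≤ Φ x / β := (one_le_div hβ).mpr hx
    simp only [χ]
    rw [min_eq_left]
    exact this.trans (le_max_right _ _)
  set η := 1 / (2 * C) with hη
  have hηp : 0 < η := by positivity
  have hηC : C * η = 1 / 2 := by rw [hη]; field_simp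
  let S : V → V := fun x => x - (η * χ x) • D x
  have hS : Continuous S := by simp only [S]; fun_prop
  have hSd : ∀ x, Φ (S x) ≤ Φ x - η / 2 * χ x * ‖D x‖ ^ 2 := by
    intro x
    have h := hdesc x (-((η * χ x) • D x))
    rw [← sub_eq_add_neg, inner_neg_right, inner_smul_right, real_inner_self_eq_norm_sq, norm_neg,
      norm_smul, mul_pow, Real.norm_eq_abs, sq_abs] at h
    refine h.trans ?_
    have h1 : C * ((η * χ x) ^ 2 * ‖D x‖ ^ 2) = η / 2 * (χ x) ^ 2 * ‖D x‖ ^ 2 := by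
      have : C * ((η * χ x) ^ 2 * ‖D x‖ ^ 2) = (C * η) * η * (χ x) ^ 2 * ‖D x‖ ^ 2 := by ring
      rw [this, hηC]; ring
    rw [h1]
    have h2 : (χ x) ^ 2 ≤ χ x := by nlinarith [hχ0 x, hχ1 x]
    have h3 : η / 2 * (χ x) ^ 2 * ‖D x‖ ^ 2 ≤ η / 2 * χ x * ‖D x‖ ^ 2 := by gcongr
    linarith
  have hSle : ∀ x, Φ (S x) ≤ Φ x := by
    intro x
    have : 0 ≤ η / 2 * χ x * ‖D x‖ ^ 2 := by have := hχ0 x; positivity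
    linarith [hSd x]
  have hSfix : ∀ x, Φ x ≤ 0 → S x = x := by
    intro x hx; simp [S, hχz x hx]
  have hit : ∀ k x, β ≤ Φ (S^[k] x) → Φ (S^[k] x) ≤ Φ x - k * (η / 2 * δ ^ 2) := by
    intro k x
    induction k with
    | zero => intro _; simp
    | succ k ih =>
      intro hk
      rw [Function.iterate_succ_apply'] at hk ⊢
      have h1 : β ≤ Φ (S^[k] x) := hk.trans (hSle _)
      have h2 := ih h1
      have h3 := hSd (S^[k] x)
      rw [hχo _ h1] at h3
      have h4 : δ ^ 2 ≤ ‖D (S^[k] x)‖ ^ 2 := by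
        have := hδD _ h1
        gcongr
      push_cast
      nlinarith
  obtain ⟨k, hk⟩ := exists_nat_gt ((M - β) / (η / 2 * δ ^ 2))
  rw [div_lt_iff₀ (by positivity)] at hk
  let h : V → V := S^[k]
  have hhc : Continuous h := hS.iterate k
  have hhfix : ∀ x, Φ x ≤ 0 → h x = x := fun x hx => Function.iterate_fixed (hSfix x hx) k
  have hhlt : ∀ w ∈ W, ∀ s : ℝ, 0 ≤ s → Φ (h (w + s • e)) < β := by
    intro w hw s hs
    by_contra hge
    push Not at hge
    have := hit k _ hge
    have := hM w hw s hs
    linarith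
  let F : W × ℝ → W × ℝ := fun z =>
    (W.orthogonalProjectionOnto (h ((z.1 : V) + (max z.2 0) • e)),
      ‖Wᗮ.orthogonalProjectionOnto (h ((z.1 : V) + (max z.2 0) • e))‖ + min z.2 0)
  have hFc : Continuous F := by
    simp only [F]; fun_prop
  have hPW : ∀ (w : W) (s : ℝ), W.orthogonalProjectionOnto ((w : V) + s • e) = w := by
    intro w s
    rw [map_add, map_smul, Submodule.orthogonalProjectionOnto_mem_subspace_eq_self]
    rw [Submodule.orthogonalProjectionOnto_eq_zero_iff.mpr he]
    simp
  have hPV : ∀ (w : W) (s : ℝ), 0 ≤ s → ‖Wᗮ.orthogonalProjectionOnto ((w : V) + s • e)‖ = s := by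
    intro w s hs
    rw [map_add, map_smul]
    have h1 : Wᗮ.orthogonalProjectionOnto (w : V) = 0 := by
      rw [Submodule.orthogonalProjectionOnto_eq_zero_iff, Submodule.orthogonal_orthogonal]
      exact w.2
    have h2 : Wᗮ.orthogonalProjectionOnto e = ⟨e, he⟩ :=
      Submodule.orthogonalProjectionOnto_mem_subspace_eq_self (⟨e, he⟩ : Wᗮ)
    rw [h1, h2, zero_add, norm_smul, Real.norm_of_nonneg hs]
    simp [hne]
  have hFid : ∀ z, Φ ((z.1 : V) + (max z.2 0) • e) ≤ 0 → F z = z := by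
    intro z hz
    have := hhfix _ hz
    simp only [F, this]
    rw [hPW, hPV _ _ (le_max_right _ _)]
    ext
    · rfl
    · simp
  obtain ⟨z, hz⟩ := surj_of_id_outside F hFc (|R|) (by
    intro z hz
    apply hFid
    by_cases hs : z.2 ≤ 0
    · rw [max_eq_right hs]; simpa using hW z.1 z.1.2
    · push Not at hs
      rw [max_eq_left hs.le]
      refine hinf _ z.1.2 _ hs.le ?_
      have hsq : ‖(z.1 : V) + z.2 • e‖ ^ 2 = ‖z.1‖ ^ 2 + z.2 ^ 2 := by
        have h0 : ⟪(z.1 : V), z.2 • e⟫ = 0 := by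
          rw [inner_smul_right, he z.1 z.1.2, mul_zero]
        rw [norm_add_sq_real, h0, norm_smul, hne]
        simp
      have : |R| ≤ ‖(z.1 : V) + z.2 • e‖ := by
        rcases le_sup_iff.mp (Prod.norm_def z ▸ hz) with h1 | h1
        · refine h1.trans (le_of_sq_le_sq ?_ (norm_nonneg _))
          rw [hsq]; nlinarith [sq_nonneg z.2]
        · refine h1.trans (le_of_sq_le_sq ?_ (norm_nonneg _))
          rw [hsq, Real.norm_eq_abs, sq_abs]; nlinarith [sq_nonneg ‖z.1‖]
      exact (le_abs_self R).trans this) (⟨p, hp⟩, α)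
  by_cases hs : z.2 ≤ 0
  · have : F z = z := hFid z (by rw [max_eq_right hs]; simpa using hW z.1 z.1.2)
    rw [this] at hz
    rw [hz] at hs
    simp at hs
    linarith
  · push Not at hs
    set y := h ((z.1 : V) + (max z.2 0) • e) with hy
    have h1 : W.orthogonalProjectionOnto y = ⟨p, hp⟩ := congrArg Prod.fst hz
    have h2 : ‖Wᗮ.orthogonalProjectionOnto y‖ + min z.2 0 = α := congrArg Prod.snd hz
    rw [min_eq_right hs.le, add_zero] at h2
    have hdec : y = p + (Wᗮ.orthogonalProjectionOnto y : V) := by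
      have := W.starProjection_add_starProjection_orthogonal y
      rw [Submodule.starProjection_apply, Submodule.starProjection_apply, h1] at this
      exact this.symm
    have h3 := hΓ _ (Wᗮ.orthogonalProjectionOnto y).2 (by simpa using h2)
    rw [← hdec] at h3
    exact absurd h3 (not_le.mpr (hhlt _ z.1.2 _ (le_max_right _ _)))
end Part2

section Part3
open AddCircle MeasureTheory

abbrev Ecn (n : ℕ) := EuclideanSpace ℂ (Fin n)
abbrev Vin (n : ℕ) (I : Finset ℤ) := EuclideanSpace ℂ (I × Fin n)

def ev {n : ℕ} {I : Finset ℤ} (x : Vin n I) (t : UnitAddCircle) : Ecn n :=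
  WithLp.toLp 2 (fun j => ∑ k : I, x (k, j) * fourier (k : ℤ) t)

def hat {n : ℕ} {I : Finset ℤ} (u : UnitAddCircle → Ecn n) : Vin n I :=
  WithLp.toLp 2 (fun i => fourierCoeff (fun t => u t i.2) i.1)

lemma ev_apply {n : ℕ} {I : Finset ℤ} (x : Vin n I) (t : UnitAddCircle) (j : Fin n) :
    ev x t j = ∑ k : I, x (k, j) * fourier (k : ℤ) t := rfl

lemma hat_apply {n : ℕ} {I : Finset ℤ} (u : UnitAddCircle → Ecn n) (i : I × Fin n) :
    (hat u : Vin n I) i = fourierCoeff (fun t => u t i.2) i.1 := rfl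

lemma ev_add {n : ℕ} {I : Finset ℤ} (x y : Vin n I) (t : UnitAddCircle) :
    ev (x + y) t = ev x t + ev y t := by
  ext j; simp [ev_apply, add_mul, Finset.sum_add_distrib]

lemma ev_sub {n : ℕ} {I : Finset ℤ} (x y : Vin n I) (t : UnitAddCircle) :
    ev (x - y) t = ev x t - ev y t := by
  ext j; simp [ev_apply, sub_mul, Finset.sum_sub_distrib]

lemma continuous_ev {n : ℕ} {I : Finset ℤ} (x : Vin n I) : Continuous (ev x) := by
  unfold ev
  refine (PiLp.continuous_toLp 2 _).comp ?_
  refine continuous_pi (fun j => ?_)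
  exact continuous_finsetSum _ (fun k _ => continuous_const.mul (fourier (k:ℤ)).continuous)

lemma cint {F : Type*} [NormedAddCommGroup F] [NormedSpace ℝ F] {f : UnitAddCircle → F} (hf : Continuous f) :
    Integrable f (haarAddCircle (T := (1:ℝ))) :=
  hf.integrable_of_hasCompactSupport (HasCompactSupport.of_compactSpace f)

lemma cinner_def (a b : ℂ) : inner ℝ a b = ((starRingEnd ℂ) a * b).re := by
  rw [Complex.inner, mul_comm]

lemma comp_dual {I : Finset ℤ} (a : I → ℂ) (u : UnitAddCircle → ℂ) (hu : Continuous u) :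
    ∫ t, inner ℝ (∑ k : I, a k * fourier (k : ℤ) t) (u t) ∂(haarAddCircle (T := (1:ℝ)))
      = ∑ k : I, inner ℝ (a k) (fourierCoeff u k) := by
  simp_rw [sum_inner]
  rw [integral_finsetSum _ (fun k _ => cint (by
    have := (fourier (T := (1:ℝ)) (k:ℤ)).continuous
    exact (continuous_const.mul this).inner hu))]
  refine Finset.sum_congr rfl (fun k _ => ?_)
  have h1 : ∀ t : UnitAddCircle, inner ℝ (a k * fourier (k:ℤ) t) (u t)
      = inner ℝ (a k) (fourier (-(k:ℤ)) t • u t) := by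
    intro t
    rw [cinner_def, cinner_def, fourier_neg]
    simp only [map_mul, smul_eq_mul]
    ring_nf
  simp_rw [h1]
  have hc : Continuous (fun t : UnitAddCircle => fourier (-(k:ℤ)) t • u t) :=
    (fourier (-(k:ℤ))).continuous.smul hu
  rw [fourierCoeff]
  exact integral_inner (cint hc) (a k)

lemma coeff_ev {n : ℕ} {I : Finset ℤ} (x : Vin n I) (j : Fin n) (k : I) :
    fourierCoeff (fun t => ev x t j) k = x (k, j) := by
  simp only [ev_apply]
  have h1 := fourierCoeff.sum (T := (1:ℝ)) (Finset.univ : Finset I) 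
    (fun (k' : I) (t : UnitAddCircle) => x (k', j) * fourier (k':ℤ) t) (fun k' _ => cint
      (continuous_const.mul (fourier (T := (1:ℝ)) (k':ℤ)).continuous))
  have h2 : (fun t : UnitAddCircle => ∑ k' : I, x (k', j) * fourier (k' : ℤ) t) =
    ∑ k' : I, (fun (t : UnitAddCircle) => x (k', j) * fourier (k':ℤ) t) := by
    ext t; simp
  rw [h2, h1]
  simp only [Finset.sum_apply]
  have h3 : ∀ k' : I, fourierCoeff (fun t : UnitAddCircle => x (k', j) * fourier (k':ℤ) t) (k:ℤ)
     = if k' = k then x (k, j) else 0 := by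
    intro k'
    rw [fourierCoeff.const_mul]
    rw [fourierCoeff_fourier]
    by_cases h : k' = k
    · subst h; simp
    · have : (k:ℤ) ≠ k' := fun h' => h (Subtype.ext h'.symm)
      simp [h, Pi.single_apply, this]
  rw [Finset.sum_congr rfl (fun k' _ => h3 k')]
  simp

lemma dual {n : ℕ} {I : Finset ℤ} (x : Vin n I) (u : UnitAddCircle → Ecn n) (hu : Continuous u) :
    ∫ t, inner ℝ (ev x t) (u t) ∂(haarAddCircle (T := (1:ℝ))) = inner ℝ x (hat u) := by
  simp only [PiLp.inner_apply]
  have hc := continuous_ev x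
  rw [integral_finsetSum _ (fun j _ => cint (by fun_prop))]
  simp only [ev_apply]
  rw [Fintype.sum_prod_type_right]
  refine Finset.sum_congr rfl (fun j _ => ?_)
  rw [comp_dual (fun k => x (k, j)) (fun t => u t j) (by fun_prop)]
  rfl

lemma parseval_w {n : ℕ} {I : Finset ℤ} (x : Vin n I) (l : Fin n → ℝ) :
    ∫ t, ∑ j, l j * ‖ev x t j‖ ^ 2 ∂(haarAddCircle (T := (1:ℝ))) = ∑ i, l i.2 * ‖x i‖ ^ 2 := by
  have hc := continuous_ev x
  rw [integral_finsetSum _ (fun j _ => cint (by fun_prop))]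
  rw [Fintype.sum_prod_type_right]
  refine Finset.sum_congr rfl (fun j _ => ?_)
  rw [integral_const_mul]
  dsimp only
  rw [← Finset.mul_sum]
  congr 1
  simp_rw [← real_inner_self_eq_norm_sq]
  have := comp_dual (fun k => x (k, j)) (fun t => ev x t j) (by fun_prop)
  simp_rw [coeff_ev] at this
  exact this

lemma parseval {n : ℕ} {I : Finset ℤ} (x : Vin n I) :
    ∫ t, ‖ev x t‖ ^ 2 ∂(haarAddCircle (T := (1:ℝ))) = ‖x‖ ^ 2 := by
  have := parseval_w x (fun _ => 1)
  simp only [one_mul] at this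
  rw [EuclideanSpace.norm_sq_eq, ← this]
  simp_rw [EuclideanSpace.norm_sq_eq]

lemma bessel {n : ℕ} {I : Finset ℤ} (u : UnitAddCircle → Ecn n) (hu : Continuous u) :
    ‖(hat u : Vin n I)‖ ^ 2 ≤ ∫ t, ‖u t‖ ^ 2 ∂(haarAddCircle (T := (1:ℝ))) := by
  set x : Vin n I := hat u with hx
  have hc := continuous_ev x
  have h1 := dual x u hu
  rw [← hx, real_inner_self_eq_norm_sq] at h1
  have h2 : ∫ t, inner ℝ (ev x t) (u t) ∂(haarAddCircle (T := (1:ℝ))) ≤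
      ∫ t, (‖ev x t‖ ^ 2 / 2 + ‖u t‖ ^ 2 / 2) ∂(haarAddCircle (T := (1:ℝ))) := by
    refine integral_mono (cint (by fun_prop)) (cint (by fun_prop)) (fun t => ?_)
    have := real_inner_le_norm (ev x t) (u t)
    simp only
    nlinarith [sq_nonneg (‖ev x t‖ - ‖u t‖)]
  rw [integral_add (cint (by fun_prop)) (cint (by fun_prop)), integral_div, integral_div,
    parseval] at h2
  linarith

lemma hat_sub {n : ℕ} {I : Finset ℤ} (u v : UnitAddCircle → Ecn n) (hu : Continuous u) (hv : Continuous v) :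
    (hat (fun t => u t - v t) : Vin n I) = hat u - hat v := by
  ext i
  simp only [hat_apply, PiLp.sub_apply, fourierCoeff]
  rw [← integral_sub]
  · simp [smul_sub, mul_sub]
  · exact cint ((fourier (-(i.1:ℤ))).continuous.smul (by fun_prop))
  · exact cint ((fourier (-(i.1:ℤ))).continuous.smul (by fun_prop))
end Part3

section Part4
open AddCircle MeasureTheory

structure GH (n : ℕ) (j0 : Fin n) (l : Fin n → ℝ) (θ c0 L B B' LH ρ : ℝ) (K : Ecn n → ℝ)
    (DK : Ecn n → Ecn n) (p : Ecn n) : Prop where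
  hθ : 0 < θ
  gap : ∀ (k : ℤ) j, θ ≤ |Real.pi * k - l j|
  lpos : ∀ j, θ ≤ l j
  lj0 : Real.pi + θ ≤ l j0
  Kc : Continuous K
  DKc : Continuous DK
  hL : 0 ≤ L
  Ktay : ∀ x h, |K (x + h) - K x - ⟪DK x, h⟫| ≤ L * ‖h‖ ^ 2
  DKlip : ∀ x y, ‖DK x - DK y‖ ≤ L * ‖x - y‖
  DKB : ∀ x, ‖DK x‖ ≤ B
  KB : ∀ x, |K x| ≤ B'
  Hnn : ∀ z : Ecn n, 0 ≤ ∑ j, l j * ‖z j‖ ^ 2 + c0 + K z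
  hLH : 0 < LH
  hρ : 0 < ρ
  hup : ∀ z : Ecn n, ‖z - p‖ < ρ → ∀ h : Ecn n,
    ∑ j, l j * ‖(z + h) j‖ ^ 2 + c0 + K (z + h) ≤ LH * ‖h‖ ^ 2

def mu {n : ℕ} (l : Fin n → ℝ) {I : Finset ℤ} (i : I × Fin n) : ℝ := Real.pi * (i.1 : ℤ) - l i.2

def Phi {n : ℕ} (l : Fin n → ℝ) (c0 : ℝ) (K : Ecn n → ℝ) {I : Finset ℤ} (x : Vin n I) : ℝ :=
  ∑ i, mu l i * ‖x i‖ ^ 2 - c0 - ∫ t, K (ev x t) ∂(haarAddCircle (T := (1:ℝ)))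

def DPhi {n : ℕ} (l : Fin n → ℝ) (DK : Ecn n → Ecn n) {I : Finset ℤ} (x : Vin n I) : Vin n I :=
  WithLp.toLp 2 (fun i => (2 * mu l i) • x i) - hat (fun t => DK (ev x t))

def Wsub (n : ℕ) (I : Finset ℤ) : Submodule ℝ (Vin n I) where
  carrier := {x | ∀ i : I × Fin n, 0 < (i.1 : ℤ) → x i = 0}
  add_mem' := by
    intro a b ha hb i hi
    simp [ha i hi, hb i hi]
  zero_mem' := by intro i hi; rfl
  smul_mem' := by
    intro c a ha i hi
    simp [ha i hi]

lemma inner_lin {n : ℕ} {I : Finset ℤ} (m : I × Fin n → ℝ) (x h : Vin n I) :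
    inner ℝ (WithLp.toLp 2 (fun i => m i • x i) : Vin n I) h = ∑ i, m i * inner ℝ (x i) (h i) := by
  rw [PiLp.inner_apply]
  refine Finset.sum_congr rfl (fun i _ => ?_)
  simp only [real_inner_smul_left]

lemma ev_bound {n : ℕ} {I : Finset ℤ} (x : Vin n I) (t : UnitAddCircle) :
    ‖ev x t‖ ≤ ∑ i, ‖x i‖ := by
  have h0 : ev x t = ∑ j, EuclideanSpace.single j (ev x t j) := by
    ext j; simp
  rw [h0]
  refine (norm_sum_le _ _).trans ?_
  rw [Fintype.sum_prod_type_right]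
  refine Finset.sum_le_sum (fun j _ => ?_)
  rw [PiLp.norm_single, ev_apply]
  refine (norm_sum_le _ _).trans ?_
  refine Finset.sum_le_sum (fun k _ => ?_)
  rw [norm_mul]
  rw [fourier_apply, Circle.norm_coe, mul_one]

lemma norm_coord_le {n : ℕ} {I : Finset ℤ} (x : Vin n I) (i : I × Fin n) : ‖x i‖ ≤ ‖x‖ :=
  PiLp.norm_apply_le x i

section
variable {n : ℕ} {j0 : Fin n} {l : Fin n → ℝ} {θ c0 L B B' LH ρ : ℝ} {K : Ecn n → ℝ}
    {DK : Ecn n → Ecn n} {p : Ecn n}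

lemma Phi_eq (hg : GH n j0 l θ c0 L B B' LH ρ K DK p) {I : Finset ℤ} (x : Vin n I) :
    Phi l c0 K x = ∑ i, (Real.pi * (i.1 : ℤ)) * ‖x i‖ ^ 2
      - ∫ t, (∑ j, l j * ‖ev x t j‖ ^ 2 + c0 + K (ev x t)) ∂(haarAddCircle (T := (1:ℝ))) := by
  have hc := continuous_ev x
  have hK := hg.Kc
  rw [integral_add (cint (by fun_prop)) (cint (by fun_prop)),
    integral_add (cint (by fun_prop)) (cint (by fun_prop)), parseval_w]
  simp only [Phi, mu, sub_mul, Finset.sum_sub_distrib, integral_const, probReal_univ, one_smul]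
  ring

lemma Phi_desc (hg : GH n j0 l θ c0 L B B' LH ρ K DK p) {I : Finset ℤ} (x h : Vin n I) :
    Phi l c0 K (x + h) ≤ Phi l c0 K x + ⟪DPhi l DK x, h⟫
      + (∑ i : I × Fin n, |mu l i| + L + 1) * ‖h‖ ^ 2 := by
  have hcx := continuous_ev x
  have hch := continuous_ev h
  have hcxh := continuous_ev (x + h)
  have hK := hg.Kc
  have hDK := hg.DKc
  have e1 : ⟪DPhi l DK x, h⟫ = ∑ i, (2 * mu l i) * inner ℝ (x i) (h i)
      - ∫ t, inner ℝ (ev h t) (DK (ev x t)) ∂(haarAddCircle (T := (1:ℝ))) := by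
    rw [DPhi, inner_sub_left, inner_lin, dual h (fun t => DK (ev x t)) (by fun_prop),
      real_inner_comm h]
  have e2 : ∑ i, mu l i * ‖(x + h) i‖ ^ 2 = ∑ i, mu l i * ‖x i‖ ^ 2 +
      ∑ i, (2 * mu l i) * inner ℝ (x i) (h i) + ∑ i, mu l i * ‖h i‖ ^ 2 := by
    rw [← Finset.sum_add_distrib, ← Finset.sum_add_distrib]
    refine Finset.sum_congr rfl (fun i _ => ?_)
    rw [PiLp.add_apply, norm_add_sq_real]
    ring
  have e3 : ∑ i, mu l i * ‖h i‖ ^ 2 ≤ (∑ i : I × Fin n, |mu l i|) * ‖h‖ ^ 2 := by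
    rw [Finset.sum_mul]
    refine Finset.sum_le_sum (fun i _ => ?_)
    refine mul_le_mul (le_abs_self _) ?_ (by positivity) (by positivity)
    have := norm_coord_le h i
    gcongr
  have e4 : ∫ t, (K (ev x t) + inner ℝ (ev h t) (DK (ev x t)) - L * ‖ev h t‖ ^ 2)
      ∂(haarAddCircle (T := (1:ℝ))) ≤ ∫ t, K (ev (x + h) t) ∂(haarAddCircle (T := (1:ℝ))) := by
    refine integral_mono (cint (by fun_prop)) (cint (by fun_prop)) (fun t => ?_)
    have := (abs_le.1 (hg.Ktay (ev x t) (ev h t))).1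
    rw [← ev_add, real_inner_comm] at this
    simp only
    linarith
  rw [integral_sub (cint (by fun_prop)) (cint (by fun_prop)),
    integral_add (cint (by fun_prop)) (cint (by fun_prop)), integral_const_mul, parseval] at e4
  rw [e1]
  unfold Phi
  rw [e2]
  nlinarith [sq_nonneg ‖h‖]

lemma hat_bound (hg : GH n j0 l θ c0 L B B' LH ρ K DK p) {I : Finset ℤ} (x : Vin n I) :
    ‖(hat (fun t => DK (ev x t)) : Vin n I)‖ ^ 2 ≤ B ^ 2 := by
  have hcx := continuous_ev x
  have hDK := hg.DKc
  refine (bessel _ (by fun_prop)).trans ?_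
  have : ∫ t, ‖DK (ev x t)‖ ^ 2 ∂(haarAddCircle (T := (1:ℝ))) ≤
      ∫ t, B ^ 2 ∂(haarAddCircle (T := (1:ℝ))) := by
    refine integral_mono (cint (by fun_prop)) (cint (by fun_prop)) (fun t => ?_)
    have := hg.DKB (ev x t)
    simp only
    gcongr
  simpa using this

lemma DPhi_cont (hg : GH n j0 l θ c0 L B B' LH ρ K DK p) {I : Finset ℤ} :
    Continuous (DPhi l DK : Vin n I → Vin n I) := by
  unfold DPhi
  refine Continuous.sub (by fun_prop) ?_
  have hL := hg.hL
  have : LipschitzWith ⟨L, hg.hL⟩ (fun x : Vin n I => (hat (fun t => DK (ev x t)) : Vin n I)) := by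
    refine LipschitzWith.of_dist_le_mul (fun x y => ?_)
    have hcx := continuous_ev x
    have hcy := continuous_ev y
    have hcxy := continuous_ev (x - y)
    have hDK := hg.DKc
    rw [dist_eq_norm, dist_eq_norm, ← hat_sub _ _ (by fun_prop) (by fun_prop)]
    refine abs_le_of_sq_le_sq' ?_ (by positivity) |>.2
    refine (bessel _ (by fun_prop)).trans ?_
    have : ∫ t, ‖DK (ev x t) - DK (ev y t)‖ ^ 2 ∂(haarAddCircle (T := (1:ℝ))) ≤
      ∫ t, L ^ 2 * ‖ev (x - y) t‖ ^ 2 ∂(haarAddCircle (T := (1:ℝ))) := by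
      refine integral_mono (cint (by fun_prop)) (cint (by fun_prop)) (fun t => ?_)
      have := hg.DKlip (ev x t) (ev y t)
      simp only
      rw [ev_sub, ← mul_pow]
      gcongr
    rw [integral_const_mul, parseval, ← mul_pow] at this
    exact this
  exact this.continuous

lemma Phi_cont (hg : GH n j0 l θ c0 L B B' LH ρ K DK p) {I : Finset ℤ} :
    Continuous (Phi l c0 K : Vin n I → ℝ) := by
  have hK := hg.Kc
  unfold Phi
  refine Continuous.sub (by fun_prop) ?_
  refine continuous_of_dominated (bound := fun _ => B') ?_ ?_ (integrable_const _) ?_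
  · intro x
    have hcx := continuous_ev x
    exact (cint (by fun_prop)).aestronglyMeasurable
  · intro x
    exact Filter.Eventually.of_forall (fun t => by simpa using hg.KB _)
  · refine Filter.Eventually.of_forall (fun t => ?_)
    refine hK.comp ?_
    unfold ev
    refine (PiLp.continuous_toLp 2 _).comp ?_
    refine continuous_pi (fun j => ?_)
    exact continuous_finsetSum _ (fun k _ => by fun_prop)

lemma mu_ge (hg : GH n j0 l θ c0 L B B' LH ρ K DK p) {I : Finset ℤ} (i : I × Fin n) :
    θ ≤ |mu l i| := hg.gap _ _

lemma lin_ge (hg : GH n j0 l θ c0 L B B' LH ρ K DK p) {I : Finset ℤ} (x : Vin n I) :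
    2 * θ * ‖x‖ ≤ ‖(WithLp.toLp 2 (fun i => (2 * mu l i) • x i) : Vin n I)‖ := by
  have hθ := hg.hθ
  refine abs_le_of_sq_le_sq' ?_ (by positivity) |>.2
  rw [mul_pow, EuclideanSpace.norm_sq_eq, EuclideanSpace.norm_sq_eq, Finset.mul_sum]
  refine Finset.sum_le_sum (fun i _ => ?_)
  simp only [norm_smul, mul_pow, Real.norm_eq_abs, abs_mul, abs_two]
  have := mu_ge hg i
  gcongr

lemma PS (hg : GH n j0 l θ c0 L B B' LH ρ K DK p) {I : Finset ℤ} (x : Vin n I) :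
    (2 * θ) * ‖x‖ - |B| ≤ ‖DPhi l DK x‖ := by
  have h1 := lin_ge hg x
  have h2 : ‖(hat (fun t => DK (ev x t)) : Vin n I)‖ ≤ |B| := by
    refine abs_le_of_sq_le_sq' ?_ (by positivity) |>.2
    rw [sq_abs]; exact hat_bound hg x
  have h3 := norm_sub_norm_le (WithLp.toLp 2 (fun i => (2 * mu l i) • x i) : Vin n I)
    (hat (fun t => DK (ev x t)) : Vin n I)
  unfold DPhi
  linarith

lemma Phi_W (hg : GH n j0 l θ c0 L B B' LH ρ K DK p) {I : Finset ℤ} (x : Vin n I)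
    (hx : x ∈ Wsub n I) : Phi l c0 K x ≤ 0 := by
  rw [Phi_eq hg]
  have h1 : ∑ i, (Real.pi * (i.1 : ℤ)) * ‖x i‖ ^ 2 ≤ 0 := by
    refine Finset.sum_nonpos (fun i _ => ?_)
    rcases lt_or_ge 0 (i.1 : ℤ) with h | h
    · simp [hx i h]
    · have : ((i.1 : ℤ) : ℝ) ≤ 0 := by exact_mod_cast h
      have h2 : Real.pi * ((i.1 : ℤ) : ℝ) ≤ 0 := mul_nonpos_of_nonneg_of_nonpos Real.pi_pos.le this
      exact mul_nonpos_of_nonpos_of_nonneg h2 (by positivity)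
  have h2 : 0 ≤ ∫ t, (∑ j, l j * ‖ev x t j‖ ^ 2 + c0 + K (ev x t)) ∂(haarAddCircle (T := (1:ℝ))) :=
    integral_nonneg (fun t => hg.Hnn _)
  linarith

lemma Phi_inf (hg : GH n j0 l θ c0 L B B' LH ρ K DK p) {I : Finset ℤ} (x : Vin n I)
    (hx : ∀ i, mu l i * ‖x i‖ ^ 2 ≤ -θ * ‖x i‖ ^ 2) : Phi l c0 K x ≤ -θ * ‖x‖ ^ 2 + |c0| + B' := by
  have hcx := continuous_ev x
  have hK := hg.Kc
  have h1 : ∑ i, mu l i * ‖x i‖ ^ 2 ≤ -θ * ‖x‖ ^ 2 := by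
    rw [EuclideanSpace.norm_sq_eq, Finset.mul_sum]
    exact Finset.sum_le_sum (fun i _ => hx i)
  have h2 : ∫ t, (-B') ∂(haarAddCircle (T := (1:ℝ))) ≤ ∫ t, K (ev x t) ∂(haarAddCircle (T := (1:ℝ))) := by
    refine integral_mono (cint (by fun_prop)) (cint (by fun_prop)) (fun t => ?_)
    exact (abs_le.1 (hg.KB _)).1
  simp only [integral_const, probReal_univ, one_smul] at h2
  unfold Phi
  have := neg_abs_le c0
  linarith
end
end Part4

section Part5
open AddCircle MeasureTheory

def cloop {n : ℕ} (I : Finset ℤ) (p : Ecn n) : Vin n I :=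
  WithLp.toLp 2 (fun i => if (i.1 : ℤ) = 0 then p i.2 else 0)

lemma ev_cloop {n : ℕ} {I : Finset ℤ} (h0 : (0:ℤ) ∈ I) (p : Ecn n) (t : UnitAddCircle) :
    ev (cloop I p) t = p := by
  ext j
  rw [ev_apply, Finset.sum_eq_single (⟨0, h0⟩ : I)]
  · simp [cloop]
  · intro k _ hk
    have : (k : ℤ) ≠ 0 := fun h => hk (Subtype.ext h)
    simp [cloop, this]
  · simp

def lowp {n : ℕ} {I : Finset ℤ} (k0 : ℕ) (y : Vin n I) : Vin n I :=
  WithLp.toLp 2 (fun i => if (i.1 : ℤ) ≤ k0 then y i else 0)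

lemma low_bound {n : ℕ} {I : Finset ℤ} (k0 : ℕ) (y : Vin n I)
    (hy : ∀ i : I × Fin n, (i.1 : ℤ) ≤ 0 → y i = 0) (t : UnitAddCircle) :
    ‖ev (lowp k0 y) t‖ ≤ n * k0 * ‖y‖ := by
  refine (ev_bound _ t).trans ?_
  have h1 : ∀ i : I × Fin n, ‖lowp k0 y i‖ ≤
      (if (i.1:ℤ) ∈ Finset.Icc (1:ℤ) k0 then ‖y‖ else 0) := by
    intro i
    simp only [lowp, Finset.mem_Icc]
    by_cases h : (i.1:ℤ) ≤ 0
    · have := hy i h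
      rw [this]
      simp only [ite_self, norm_zero]
      split_ifs <;> positivity
    · by_cases h' : (i.1:ℤ) ≤ k0
      · rw [if_pos h', if_pos ⟨by omega, h'⟩]
        exact norm_coord_le y i
      · rw [if_neg h', if_neg (fun hh => h' hh.2), norm_zero]
  refine (Finset.sum_le_sum (fun i _ => h1 i)).trans ?_
  rw [Fintype.sum_prod_type_right]
  refine (Finset.sum_le_card_nsmul _ _ (k0 * ‖y‖) (fun j _ => ?_)).trans ?_
  · have h2 : (Finset.filter (fun a => a ∈ Finset.Icc (1:ℤ) k0) I).card ≤ k0 := by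
      refine (Finset.card_le_card (t := Finset.Icc (1:ℤ) k0) ?_).trans (by simp)
      intro a ha
      exact (Finset.mem_filter.1 ha).2
    have h3 : ((Finset.filter (fun a => a ∈ Finset.Icc (1:ℤ) k0) I).card : ℝ) ≤ k0 := by
      exact_mod_cast h2
    have h4 := Finset.sum_coe_sort I (fun k => if k ∈ Finset.Icc (1:ℤ) k0 then ‖y‖ else 0)
    refine (le_of_eq h4).trans ?_
    rw [← Finset.sum_filter, Finset.sum_const, nsmul_eq_mul]
    gcongr
  · simp only [Finset.card_univ, Fintype.card_fin, nsmul_eq_mul]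
    rw [mul_assoc]

section
variable {n : ℕ} {j0 : Fin n} {l : Fin n → ℝ} {θ c0 L B B' LH ρ : ℝ} {K : Ecn n → ℝ}
    {DK : Ecn n → Ecn n} {p : Ecn n}

lemma Phi_Gamma (hg : GH n j0 l θ c0 L B B' LH ρ K DK p) {I : Finset ℤ} (h0 : (0:ℤ) ∈ I)
    (k0 : ℕ) (hk0 : LH + 1 ≤ k0) (y : Vin n I) (hy : ∀ i : I × Fin n, (i.1 : ℤ) ≤ 0 → y i = 0)
    (hsm : n * k0 * ‖y‖ < ρ) : ‖y‖ ^ 2 ≤ Phi l c0 K (cloop I p + y) := by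
  have hLH := hg.hLH
  have hK := hg.Kc
  set lo := lowp k0 y with hlo
  have hch := continuous_ev (y - lo)
  have hcy := continuous_ev (cloop I p + y)
  rw [Phi_eq hg]
  have h1 : ∫ t, (∑ j, l j * ‖ev (cloop I p + y) t j‖ ^ 2 + c0 + K (ev (cloop I p + y) t))
      ∂(haarAddCircle (T := (1:ℝ))) ≤ ∫ t, LH * ‖ev (y - lo) t‖ ^ 2 ∂(haarAddCircle (T := (1:ℝ))) := by
    refine integral_mono (cint (by fun_prop)) (cint (by fun_prop)) (fun t => ?_)
    have e : ev (cloop I p + y) t = (p + ev lo t) + ev (y - lo) t := by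
      rw [ev_add, ev_cloop h0, ev_sub]; abel
    simp only
    rw [e]
    refine hg.hup _ ?_ _
    rw [add_sub_cancel_left]
    exact (low_bound k0 y hy t).trans_lt hsm
  rw [integral_const_mul, parseval] at h1
  have h2 : ‖y‖ ^ 2 + LH * ‖y - lo‖ ^ 2 ≤ ∑ i, (Real.pi * (i.1 : ℤ)) * ‖(cloop I p + y) i‖ ^ 2 := by
    rw [EuclideanSpace.norm_sq_eq, EuclideanSpace.norm_sq_eq, Finset.mul_sum,
      ← Finset.sum_add_distrib]
    refine Finset.sum_le_sum (fun i _ => ?_)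
    have hpi := Real.pi_gt_three
    rcases lt_trichotomy (i.1 : ℤ) 0 with h | h | h
    · have e1 : lo i = 0 := by
        simp only [hlo, lowp]; rw [hy i h.le]; simp
      have e2 : cloop I p i = 0 := by simp [cloop, h.ne]
      rw [PiLp.sub_apply, PiLp.add_apply, e1, e2, hy i h.le]; simp
    · have e1 : lo i = 0 := by
        simp only [hlo, lowp]; rw [hy i h.le]; simp
      rw [PiLp.sub_apply, PiLp.add_apply, e1, hy i h.le, h]; simp
    · have e2 : cloop I p i = 0 := by simp [cloop, h.ne']
      rw [PiLp.add_apply, e2, zero_add]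
      by_cases h' : (i.1:ℤ) ≤ k0
      · have e1 : lo i = y i := by simp only [hlo, lowp]; rw [if_pos h']
        rw [PiLp.sub_apply, e1]
        simp only [sub_self, norm_zero]
        have : (1:ℝ) ≤ (i.1:ℤ) := by exact_mod_cast h
        have h3 : 1 ≤ Real.pi * (i.1:ℤ) := by nlinarith
        nlinarith [sq_nonneg ‖y i‖]
      · have e1 : lo i = 0 := by simp only [hlo, lowp]; rw [if_neg h']
        rw [PiLp.sub_apply, e1, sub_zero]
        have : (k0:ℝ) ≤ (i.1:ℤ) := by exact_mod_cast (not_le.1 h').le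
        have h3 : 1 + LH ≤ Real.pi * (i.1:ℤ) := by nlinarith
        nlinarith [sq_nonneg ‖y i‖]
  linarith

lemma crit_ex (hg : GH n j0 l θ c0 L B B' LH ρ K DK p) :
    ∃ β > 0, ∀ I : Finset ℤ, (0:ℤ) ∈ I → (1:ℤ) ∈ I → ∃ x : Vin n I,
      DPhi l DK x = 0 ∧ β ≤ Phi l c0 K x := by
  have hLH := hg.hLH
  have hρ := hg.hρ
  have hθ := hg.hθ
  have hL := hg.hL
  obtain ⟨k0, hk0⟩ := exists_nat_ge (LH + 1)
  set α : ℝ := ρ / (2 * (n * k0 + 1)) with hα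
  have hαpos : 0 < α := by positivity
  have hαs : n * k0 * α < ρ := by
    rw [hα, mul_div_assoc', div_lt_iff₀ (by positivity)]
    have : (0:ℝ) ≤ n * k0 := by positivity
    nlinarith
  refine ⟨α ^ 2, by positivity, fun I h0 h1 => ?_⟩
  set i1 : I × Fin n := (⟨1, h1⟩, j0) with hi1
  have hB' : 0 ≤ B' := (abs_nonneg _).trans (hg.KB 0)
  set e : Vin n I := EuclideanSpace.single i1 1 with he
  have hei : ∀ i : I × Fin n, i ≠ i1 → e i = 0 := by
    intro i hi
    simp [he, hi]
  set R : ℝ := (|c0| + B') / θ + 1 with hR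
  refine minimax (Wsub n I) e ?_ ?_ (cloop I p) ?_ (Phi l c0 K) (DPhi l DK) (Phi_cont hg)
    (DPhi_cont hg) (∑ i : I × Fin n, |mu l i| + L + 1) ?_ (Phi_desc hg) (2 * θ) |B| (by positivity)
    (PS hg) (fun w hw => Phi_W hg w hw) R ?_ α (α ^ 2) hαpos (by positivity) ?_
  · rw [Submodule.mem_orthogonal]
    intro w hw
    rw [PiLp.inner_apply]
    refine Finset.sum_eq_zero (fun i _ => ?_)
    by_cases hi : i = i1
    · rw [hw i (by rw [hi]; simp [hi1]), inner_zero_left]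
    · rw [hei i hi, inner_zero_right]
  · simp [he]
  · intro i hi
    simp [cloop, hi.ne']
  · have : 0 ≤ ∑ i : I × Fin n, |mu l i| := Finset.sum_nonneg (fun i _ => abs_nonneg _)
    linarith
  · intro w hw s hs hRs
    have h2 := Phi_inf hg (w + s • e) ?_
    · refine h2.trans ?_
      have hR1 : 1 ≤ R := by rw [hR]; have : 0 ≤ (|c0| + B') / θ := by positivity
                             linarith
      have h3 : R ≤ ‖w + s • e‖ ^ 2 := by nlinarith
      have h4 : θ * R = |c0| + B' + θ := by rw [hR]; field_simp
      nlinarith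
    · intro i
      by_cases hi : 0 < (i.1:ℤ)
      · by_cases hii : i = i1
        · have : mu l i ≤ -θ := by
            have := hg.lj0
            rw [hii]; simp only [mu, hi1]; push_cast; linarith
          gcongr
        · have : (w + s • e) i = 0 := by
            rw [PiLp.add_apply, PiLp.smul_apply, hei i hii, hw i hi]; simp
          rw [this]; simp
      · have : mu l i ≤ -θ := by
          have h5 := hg.lpos i.2
          have h6 : ((i.1:ℤ):ℝ) ≤ 0 := by exact_mod_cast not_lt.1 hi
          have := Real.pi_pos
          simp only [mu]; nlinarith
        gcongr
  · intro y hy hyα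
    rw [← hyα]
    refine Phi_Gamma hg h0 k0 hk0 y ?_ (by rw [hyα]; exact hαs)
    intro i hi
    rw [Submodule.mem_orthogonal] at hy
    have h3 := hy (EuclideanSpace.single i (y i)) (by
      intro i' hi'
      have : i' ≠ i := by rintro rfl; omega
      simp [this])
    rw [PiLp.inner_apply, Finset.sum_eq_single i] at h3
    · simpa using h3
    · intro i' _ hi'
      simp [hi']
    · simp

lemma galerkin (hg : GH n j0 l θ c0 L B B' LH ρ K DK p) :
    ∃ β > 0, ∃ Bd : ℝ, ∀ I : Finset ℤ, (0:ℤ) ∈ I → (1:ℤ) ∈ I → ∃ x : Vin n I,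
      (∀ i : I × Fin n, ((2 * (Real.pi * (i.1:ℤ) - l i.2) : ℝ) : ℂ) * x i
        = fourierCoeff (fun t => DK (ev x t) i.2) i.1) ∧
      β ≤ ∫ t, (1 / 2 * inner ℝ (ev x t) (DK (ev x t)) - c0 - K (ev x t)) 
        ∂(haarAddCircle (T := (1:ℝ))) ∧
      ∑ i : I × Fin n, (1 + ((i.1:ℤ):ℝ) ^ 2) * ‖x i‖ ^ 2 ≤ Bd := by
  obtain ⟨β, hβ, H⟩ := crit_ex hg
  have hθ := hg.hθ
  set Λ : ℝ := ∑ j, l j with hΛ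
  have hlΛ : ∀ j, l j ≤ Λ := fun j =>
    Finset.single_le_sum (f := l) (fun j _ => hθ.le.trans (hg.lpos j)) (Finset.mem_univ j)
  have hl0 : ∀ j, 0 ≤ l j := fun j => hθ.le.trans (hg.lpos j)
  set M : ℝ := 1 / θ ^ 2 + (1 + Λ / θ) ^ 2 with hM
  have hM0 : 0 ≤ M := by positivity
  refine ⟨β, hβ, M * B ^ 2, fun I h0 h1 => ?_⟩
  obtain ⟨x, hx, hx2⟩ := H I h0 h1
  have hcx := continuous_ev x
  have hK := hg.Kc
  have hDK := hg.DKc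
  have hx' : (WithLp.toLp 2 (fun i => (2 * mu l i) • x i) : Vin n I) = hat (fun t => DK (ev x t)) :=
    sub_eq_zero.1 hx
  refine ⟨x, ?_, ?_, ?_⟩
  · intro i
    have := congrArg (fun v : Vin n I => v i) hx'
    simp only [hat_apply] at this
    rw [← this, Complex.real_smul, mu]
  · refine hx2.trans (le_of_eq ?_)
    rw [integral_sub (cint (by fun_prop)) (cint (by fun_prop)),
      integral_sub (cint (by fun_prop)) (cint (by fun_prop)), integral_const_mul,
      dual x (fun t => DK (ev x t)) (by fun_prop), ← hx', real_inner_comm, inner_lin]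
    simp only [integral_const, probReal_univ, one_smul, real_inner_self_eq_norm_sq]
    rw [Phi, Finset.mul_sum]
    congr 2
    refine Finset.sum_congr rfl (fun i _ => ?_)
    ring
  · have h2 := hat_bound hg x
    rw [← hx', EuclideanSpace.norm_sq_eq] at h2
    have h3 : ∀ i : I × Fin n, (1 + ((i.1:ℤ):ℝ) ^ 2) * ‖x i‖ ^ 2 ≤ M * ‖(2 * mu l i) • x i‖ ^ 2 := by
      intro i
      rw [norm_smul, mul_pow, ← mul_assoc]
      refine mul_le_mul_of_nonneg_right ?_ (by positivity)
      rw [Real.norm_eq_abs, sq_abs, mul_pow]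
      have g := mu_ge hg i
      have a1 : 1 ≤ |mu l i| / θ := by rw [le_div_iff₀ hθ]; linarith
      have a2 : |((i.1:ℤ):ℝ)| ≤ |mu l i| * (1 + Λ / θ) := by
        have b1 : |((i.1:ℤ):ℝ)| ≤ |Real.pi * ((i.1:ℤ):ℝ)| := by
          rw [abs_mul, abs_of_pos Real.pi_pos]
          nlinarith [Real.pi_gt_three, abs_nonneg ((i.1:ℤ):ℝ)]
        have b2 : |Real.pi * ((i.1:ℤ):ℝ)| ≤ |mu l i| + Λ := by
          have : Real.pi * ((i.1:ℤ):ℝ) = mu l i + l i.2 := by simp [mu]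
          rw [this]
          refine (abs_add_le _ _).trans ?_
          rw [abs_of_nonneg (hl0 _)]
          linarith [hlΛ i.2]
        have hΛ0 : 0 ≤ Λ := Finset.sum_nonneg (fun j _ => hl0 j)
        have b3 : Λ ≤ |mu l i| * (Λ / θ) := by
          calc Λ = 1 * Λ := by ring
            _ ≤ (|mu l i| / θ) * Λ := by gcongr
            _ = _ := by ring
        linarith
      have a3 : ((i.1:ℤ):ℝ) ^ 2 ≤ mu l i ^ 2 * (1 + Λ / θ) ^ 2 := by
        rw [← sq_abs ((i.1:ℤ):ℝ), ← sq_abs (mu l i), ← mul_pow]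
        gcongr
      have a4 : 1 ≤ mu l i ^ 2 * (1 / θ ^ 2) := by
        have : 1 ≤ (|mu l i| / θ) ^ 2 := one_le_pow₀ a1
        rw [div_pow, sq_abs] at this
        rw [mul_one_div]; exact this
      have a5 : 0 ≤ mu l i ^ 2 * M := by positivity
      rw [hM] at a5 ⊢
      nlinarith
    calc _ ≤ ∑ i, M * ‖(2 * mu l i) • x i‖ ^ 2 := Finset.sum_le_sum (fun i _ => h3 i)
      _ = M * ∑ i, ‖(2 * mu l i) • x i‖ ^ 2 := by rw [Finset.mul_sum]
      _ ≤ _ := by gcongr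
end
end Part5

section Part6
open AddCircle MeasureTheory

lemma wsum : Summable (fun k : ℤ => 1 / (1 + (k:ℝ) ^ 2)) := by
  have h := (Real.summable_one_div_int_pow (p := 2)).2 (by norm_num)
  have h2 : Summable (fun k : ℤ => (Set.indicator {0} (fun _ => (1:ℝ)) k) + 1 / (k:ℝ) ^ 2) := by
    refine Summable.add ?_ h
    refine summable_of_hasFiniteSupport ?_
    exact (Set.finite_singleton (0:ℤ)).subset Set.support_indicator_subset
  refine Summable.of_nonneg_of_le (fun k => by positivity) (fun k => ?_) h2
  by_cases hk : k = 0
  · simp [hk]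
  · have : (0:ℝ) < (k:ℝ) ^ 2 := by positivity
    simp only [Set.indicator, Set.mem_singleton_iff, hk, if_false, zero_add]
    exact one_div_le_one_div_of_le this (by linarith)

lemma wcs {n : ℕ} {I : Finset ℤ} (x : Vin n I) (c : ℤ → ℂ)
    (hc : Summable (fun k : ℤ => ‖c k‖ ^ 2 / (1 + (k:ℝ) ^ 2))) (v : Ecn n)
    (hv : ∀ j, v j = ∑ k : I, x (k, j) * c k) :
    ‖v‖ ^ 2 ≤ (∑ i : I × Fin n, (1 + ((i.1:ℤ):ℝ) ^ 2) * ‖x i‖ ^ 2) *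
      ((n:ℝ) * ∑' k : ℤ, ‖c k‖ ^ 2 / (1 + (k:ℝ) ^ 2)) := by
  have h1 : ‖v‖ ≤ ∑ i : I × Fin n, ‖x i‖ * ‖c i.1‖ := by
    have h0 : v = ∑ j, EuclideanSpace.single j (v j) := by
      ext j; simp
    rw [h0]
    refine (norm_sum_le _ _).trans ?_
    rw [Fintype.sum_prod_type_right]
    refine Finset.sum_le_sum (fun j _ => ?_)
    rw [PiLp.norm_single, hv]
    refine (norm_sum_le _ _).trans ?_
    refine Finset.sum_le_sum (fun k _ => ?_)
    rw [norm_mul]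
  have h2 : (∑ i : I × Fin n, ‖x i‖ * ‖c i.1‖) ^ 2 ≤
      (∑ i : I × Fin n, (1 + ((i.1:ℤ):ℝ) ^ 2) * ‖x i‖ ^ 2) *
        ∑ i : I × Fin n, ‖c i.1‖ ^ 2 / (1 + ((i.1:ℤ):ℝ) ^ 2) := by
    refine Finset.sum_sq_le_sum_mul_sum_of_sq_le_mul _ (fun i _ => by positivity)
      (fun i _ => by positivity) (fun i _ => le_of_eq ?_)
    have : (1 + ((i.1:ℤ):ℝ) ^ 2) ≠ 0 := by positivity
    field_simp
  have h3 : ∑ i : I × Fin n, ‖c i.1‖ ^ 2 / (1 + ((i.1:ℤ):ℝ) ^ 2) ≤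
      (n:ℝ) * ∑' k : ℤ, ‖c k‖ ^ 2 / (1 + (k:ℝ) ^ 2) := by
    rw [Fintype.sum_prod_type_right]
    refine (Finset.sum_le_card_nsmul _ _ (∑' k : ℤ, ‖c k‖ ^ 2 / (1 + (k:ℝ) ^ 2))
      (fun j _ => ?_)).trans (by simp)
    refine (le_of_eq (Finset.sum_coe_sort I (fun k => ‖c k‖ ^ 2 / (1 + (k:ℝ) ^ 2)))).trans ?_
    exact hc.sum_le_tsum _ (fun k _ => by positivity)
  calc ‖v‖ ^ 2 ≤ (∑ i : I × Fin n, ‖x i‖ * ‖c i.1‖) ^ 2 := by gcongr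
    _ ≤ _ := h2
    _ ≤ _ := by
      refine mul_le_mul_of_nonneg_left h3 (Finset.sum_nonneg (fun i _ => by positivity))

lemma fnorm (k : ℤ) (t : UnitAddCircle) : ‖fourier k t‖ = 1 := by
  rw [fourier_apply, Circle.norm_coe]

def gmod (s t : UnitAddCircle) : ℝ :=
  ∑' k : ℤ, ‖fourier k t - fourier k s‖ ^ 2 / (1 + (k:ℝ) ^ 2)

lemma gmod_bd (s t : UnitAddCircle) (k : ℤ) :
    ‖fourier k t - fourier k s‖ ^ 2 / (1 + (k:ℝ) ^ 2) ≤ 4 * (1 / (1 + (k:ℝ) ^ 2)) := by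
  have h : ‖fourier k t - fourier k s‖ ≤ 2 := by
    refine (norm_sub_le _ _).trans ?_
    rw [fnorm, fnorm]; norm_num
  rw [mul_one_div]
  gcongr
  nlinarith [norm_nonneg (fourier k t - fourier k s)]

lemma gmod_summable (s t : UnitAddCircle) :
    Summable (fun k : ℤ => ‖fourier k t - fourier k s‖ ^ 2 / (1 + (k:ℝ) ^ 2)) :=
  Summable.of_nonneg_of_le (fun k => by positivity) (gmod_bd s t) (wsum.mul_left 4)

lemma gmod_cont (s : UnitAddCircle) : Continuous (gmod s) := by
  unfold gmod
  refine continuous_tsum (u := fun k : ℤ => 4 * (1 / (1 + (k:ℝ) ^ 2))) (fun k => ?_)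
    (wsum.mul_left 4) (fun k t => ?_)
  · have := (fourier (T := (1:ℝ)) k).continuous
    fun_prop
  · rw [Real.norm_of_nonneg (by positivity)]
    exact gmod_bd s t k

lemma gmod_self (s : UnitAddCircle) : gmod s s = 0 := by
  simp [gmod]

lemma ev_equi {n : ℕ} {I : Finset ℤ} (x : Vin n I) (s t : UnitAddCircle) :
    ‖ev x t - ev x s‖ ^ 2 ≤ (∑ i : I × Fin n, (1 + ((i.1:ℤ):ℝ) ^ 2) * ‖x i‖ ^ 2) *
      (n * gmod s t) := by
  refine wcs x (fun k => fourier k t - fourier k s) (gmod_summable s t) _ (fun j => ?_)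
  rw [PiLp.sub_apply, ev_apply, ev_apply, ← Finset.sum_sub_distrib]
  simp_rw [mul_sub]

lemma ev_bd {n : ℕ} {I : Finset ℤ} (x : Vin n I) (t : UnitAddCircle) :
    ‖ev x t‖ ^ 2 ≤ (∑ i : I × Fin n, (1 + ((i.1:ℤ):ℝ) ^ 2) * ‖x i‖ ^ 2) *
      (n * ∑' k : ℤ, 1 / (1 + (k:ℝ) ^ 2)) := by
  have := wcs x (fun k => fourier k t) (by simp_rw [fnorm, one_pow]; exact wsum) (ev x t)
    (fun j => rfl)
  simp_rw [fnorm, one_pow] at this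
  exact this

lemma hasDerivAt_ecn {n : ℕ} {u : ℝ → Ecn n} {d : Ecn n} {t : ℝ}
    (h : ∀ j, HasDerivAt (fun s => u s j) (d j) t) : HasDerivAt u d t := by
  have h1 : HasDerivAt (fun s => WithLp.ofLp (u s)) (WithLp.ofLp d) t := hasDerivAt_pi.2 h
  exact ((PiLp.continuousLinearEquiv 2 ℝ
    (fun _ : Fin n => ℂ)).symm.toContinuousLinearMap.hasFDerivAt.comp_hasDerivAt t h1)

lemma ev_compact {n : ℕ} (I : ℕ → Finset ℤ) (x : ∀ N, Vin n (I N)) (Bd : ℝ)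
    (hx : ∀ N, ∑ i : (I N) × Fin n, (1 + ((i.1:ℤ):ℝ) ^ 2) * ‖x N i‖ ^ 2 ≤ Bd) :
    ∃ R : ℝ, (∀ N t, ‖ev (x N) t‖ ≤ R) ∧ ∃ u : UnitAddCircle → Ecn n, Continuous u ∧
      ∃ φ : ℕ → ℕ, StrictMono φ ∧
        ∀ t, Filter.Tendsto (fun N => ev (x (φ N)) t) Filter.atTop (nhds (u t)) := by
  have hBd : 0 ≤ Bd := (Finset.sum_nonneg (fun i _ => by positivity)).trans (hx 0)
  set S := ∑' k : ℤ, 1 / (1 + (k:ℝ) ^ 2) with hS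
  have hS0 : 0 ≤ S := tsum_nonneg (fun k => by positivity)
  set R := Real.sqrt (Bd * (n * S)) with hR
  have hbd : ∀ N t, ‖ev (x N) t‖ ≤ R := by
    intro N t
    refine Real.le_sqrt_of_sq_le ((ev_bd (x N) t).trans ?_)
    have := hx N
    gcongr
  refine ⟨R, hbd, ?_⟩
  set U : ℕ → BoundedContinuousFunction UnitAddCircle (Ecn n) := fun N =>
    BoundedContinuousFunction.mkOfCompact ⟨ev (x N), continuous_ev (x N)⟩ with hU
  have hc := BoundedContinuousFunction.arzela_ascoli (closedBall (0 : Ecn n) R)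
    (isCompact_closedBall 0 R) (Set.range U) (by
      rintro _ t ⟨N, rfl⟩
      rw [mem_closedBall_zero_iff]
      exact hbd N t) (by
      intro s
      rw [Metric.equicontinuousAt_iff_right]
      intro ε hε
      have h1 : Filter.Tendsto (fun t => Bd * (n * gmod s t)) (nhds s) (nhds 0) := by
        have : Continuous (fun t => Bd * (n * gmod s t)) := by
          have := gmod_cont s
          fun_prop
        have := this.tendsto s
        simpa [gmod_self] using this
      have h2 := h1.eventually_lt_const (show (0:ℝ) < ε ^ 2 by positivity)
      filter_upwards [h2] with t ht
      rintro ⟨_, N, rfl⟩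
      rw [dist_comm, dist_eq_norm]
      refine lt_of_pow_lt_pow_left₀ 2 hε.le (lt_of_le_of_lt ?_ ht)
      refine (ev_equi (x N) s t).trans ?_
      have := hx N
      have hg : 0 ≤ gmod s t := tsum_nonneg (fun k => by positivity)
      gcongr)
  obtain ⟨u, -, φ, hφ, hu⟩ := hc.tendsto_subseq (x := U) (fun N => subset_closure ⟨N, rfl⟩)
  refine ⟨u, u.continuous, φ, hφ, fun t => ?_⟩
  exact ((BoundedContinuousFunction.lipschitz_eval_const t).continuous.tendsto u).comp hu

lemma lim_int {n : ℕ} {F : Type*} [NormedAddCommGroup F] [NormedSpace ℝ F] 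
    (v : ℕ → UnitAddCircle → Ecn n) (u : UnitAddCircle → Ecn n)
    (hv : ∀ N, Continuous (v N)) (R : ℝ) (hR : ∀ N t, ‖v N t‖ ≤ R)
    (hl : ∀ t, Filter.Tendsto (fun N => v N t) Filter.atTop (nhds (u t)))
    (G : UnitAddCircle → Ecn n → F) (hG : Continuous (fun q : UnitAddCircle × Ecn n => G q.1 q.2)) :
    Filter.Tendsto (fun N => ∫ t, G t (v N t) ∂(haarAddCircle (T := (1:ℝ)))) Filter.atTop
      (nhds (∫ t, G t (u t) ∂(haarAddCircle (T := (1:ℝ))))) := by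
  have hcomp : IsCompact ((Set.univ : Set UnitAddCircle) ×ˢ closedBall (0 : Ecn n) R) :=
    isCompact_univ.prod (isCompact_closedBall 0 R)
  obtain ⟨C, hC⟩ := hcomp.exists_bound_of_continuousOn hG.continuousOn
  refine tendsto_integral_of_dominated_convergence (fun _ => C) (fun N => ?_) (integrable_const _)
    (fun N => ?_) ?_
  · have hN := hv N
    exact (cint (f := fun t => G t (v N t)) (hG.comp (continuous_id.prodMk hN))).aestronglyMeasurable
  · refine Filter.Eventually.of_forall (fun t => hC (t, v N t) ⟨trivial, ?_⟩)
    rw [mem_closedBall_zero_iff]; exact hR N t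
  · refine Filter.Eventually.of_forall (fun t => ?_)
    exact (hG.tendsto (t, u t)).comp (tendsto_const_nhds.prodMk_nhds (hl t))

section
variable {n : ℕ} {j0 : Fin n} {l : Fin n → ℝ} {θ c0 L B B' LH ρ : ℝ} {K : Ecn n → ℝ}
    {DK : Ecn n → Ecn n} {p : Ecn n}

lemma weak_sol (hg : GH n j0 l θ c0 L B B' LH ρ K DK p) :
    ∃ u : UnitAddCircle → Ecn n, Continuous u ∧
      (∀ (k : ℤ) (j : Fin n), ((2 * (Real.pi * k - l j) : ℝ) : ℂ) * fourierCoeff (fun t => u t j) k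
        = fourierCoeff (fun t => DK (u t) j) k) ∧
      0 < ∫ t, (1 / 2 * inner ℝ (u t) (DK (u t)) - c0 - K (u t)) 
        ∂(haarAddCircle (T := (1:ℝ))) := by
  obtain ⟨β, hβ, Bd, H⟩ := galerkin hg
  have hK := hg.Kc
  have hDK := hg.DKc
  set I : ℕ → Finset ℤ := fun N => Finset.Icc (-(N:ℤ)) (N + 1) with hI
  have hx : ∀ N, _ := fun N => H (I N) (by simp only [hI, Finset.mem_Icc]; omega) (by simp only [hI, Finset.mem_Icc]; omega)
  choose x hx1 hx2 hx3 using hx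
  obtain ⟨R, hR, u, hu, φ, hφ, hl⟩ := ev_compact I x Bd hx3
  refine ⟨u, hu, ?_, ?_⟩
  · intro k j
    have a1 := lim_int (fun N => ev (x (φ N))) u (fun N => continuous_ev _) R (fun N => hR _) hl
      (fun t z => fourier (-k) t • z j) (by
        have := (fourier (T := (1:ℝ)) (-k)).continuous
        fun_prop)
    have a2 := lim_int (fun N => ev (x (φ N))) u (fun N => continuous_ev _) R (fun N => hR _) hl
      (fun t z => fourier (-k) t • (DK z) j) (by
        have := (fourier (T := (1:ℝ)) (-k)).continuous
        fun_prop)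
    have a3 := a1.const_mul ((2 * (Real.pi * k - l j) : ℝ) : ℂ)
    refine tendsto_nhds_unique a3 (a2.congr' ?_)
    filter_upwards [Filter.eventually_ge_atTop k.natAbs] with N hN
    have hNk : k ∈ I (φ N) := by
      have := hφ.id_le N
      simp only [hI, Finset.mem_Icc]
      simp only [id] at this
      omega
    have := hx1 (φ N) (⟨k, hNk⟩, j)
    rw [← coeff_ev (x (φ N)) j ⟨k, hNk⟩] at this
    exact this.symm
  · have a1 := lim_int (fun N => ev (x (φ N))) u (fun N => continuous_ev _) R (fun N => hR _) hl
      (fun t z => 1 / 2 * inner ℝ z (DK z) - c0 - K z) (by fun_prop)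
    exact hβ.trans_le (ge_of_tendsto' a1 (fun N => hx2 _))
end

lemma coeff_zero {g : UnitAddCircle → ℂ} (hg : Continuous g)
    (h : ∀ k : ℤ, k ≠ 0 → fourierCoeff g k = 0) : ∀ t, g t = fourierCoeff g 0 := by
  intro t
  have hs : Summable (fourierCoeff (⟨g, hg⟩ : C(UnitAddCircle, ℂ))) := by
    refine summable_of_hasFiniteSupport ((Set.finite_singleton (0:ℤ)).subset ?_)
    intro k hk
    by_contra hk'
    exact hk (h k hk')
  have h1 := has_pointwise_sum_fourier_series_of_summable hs t
  have h2 := hasSum_single (f := fun i => fourierCoeff (⟨g, hg⟩ : C(UnitAddCircle, ℂ)) i • fourier i t) 0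
    (fun k hk => by
      have := h k hk
      simp only [ContinuousMap.coe_mk] at this ⊢
      rw [this, zero_smul])
  have h3 := h1.unique h2
  simpa using h3

lemma fcOn_eq (f : ℝ → ℂ) (k : ℤ) (h : (0:ℝ) < 1) :
    fourierCoeffOn h f k = ∫ x in (0:ℝ)..1, fourier (-k) (x : UnitAddCircle) • f x := by
  rw [fourierCoeffOn_eq_integral]
  simp only [fourier_coe_apply, sub_zero, div_one, one_smul]

lemma weak_deriv {u w : UnitAddCircle → ℂ} (hu : Continuous u) (hw : Continuous w)
    (h : ∀ k : ℤ, ((2 * Real.pi * k : ℝ) : ℂ) * fourierCoeff u k = fourierCoeff w k) (t : ℝ) :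
    HasDerivAt (fun t : ℝ => u (t : UnitAddCircle)) (Complex.I * w (t : UnitAddCircle)) t := by
  have hcoe : Continuous (fun t : ℝ => (t : UnitAddCircle)) := AddCircle.continuous_mk' 1
  set W : ℝ → ℂ := fun t => Complex.I * w (t : UnitAddCircle) with hW
  have hWc : Continuous W := by fun_prop
  set v : ℝ → ℂ := fun t => ∫ s in (0:ℝ)..t, W s with hv
  have hvd : ∀ t, HasDerivAt v (W t) t := fun t =>
    intervalIntegral.integral_hasDerivAt_right (hWc.intervalIntegrable _ _)
      (hWc.stronglyMeasurableAtFilter _ _) hWc.continuousAt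
  have hW0 : ∫ s in (0:ℝ)..1, W s = 0 := by
    have h0 := h 0
    rw [fourierCoeff_eq_intervalIntegral w 0 0] at h0
    simp only [Int.cast_zero, mul_zero, Complex.ofReal_zero, zero_mul, neg_zero, fourier_zero, one_smul, zero_add, div_one] at h0
    simp only [hW]
    rw [intervalIntegral.integral_const_mul, ← h0, mul_zero]
  have hWp : Function.Periodic W 1 := by
    intro t
    simp only [hW]
    congr 2
    exact AddCircle.coe_add_period 1 t
  have hvp : Function.Periodic v 1 := by
    intro t
    have e := hWp.intervalIntegral_add_eq t 0
    rw [zero_add, hW0] at e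
    simp only [hv]
    rw [← intervalIntegral.integral_add_adjacent_intervals (hWc.intervalIntegrable 0 t)
      (hWc.intervalIntegrable t (t+1)), e, add_zero]
  have hvc : Continuous v := continuous_iff_continuousAt.2 (fun t => (hvd t).continuousAt)
  set V : UnitAddCircle → ℂ := hvp.lift with hV
  have hVv : ∀ t : ℝ, V (t : UnitAddCircle) = v t := fun t => hvp.lift_coe t
  have hVc : Continuous V := by
    have : Topology.IsQuotientMap (fun t : ℝ => (t : UnitAddCircle)) := isQuotientMap_quotient_mk'
    rw [this.continuous_iff]
    have e : V ∘ (fun t : ℝ => (t : UnitAddCircle)) = v := funext hVv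
    rw [e]; exact hvc
  have hcoef : ∀ k : ℤ, k ≠ 0 → fourierCoeff V k = fourierCoeff u k := by
    intro k hk
    have e1 := fourierCoeffOn_of_hasDerivAt (a := 0) (b := 1) one_pos (f := v) (f' := W) hk
      (fun x _ => hvd x) (hWc.intervalIntegrable _ _)
    have e2 : v 1 - v 0 = 0 := by have := hvp 0; rw [zero_add] at this; rw [this, sub_self]
    rw [e2, fcOn_eq, fcOn_eq] at e1
    have e3 := fourierCoeff_eq_intervalIntegral V k 0
    have e4 := fourierCoeff_eq_intervalIntegral w k 0
    simp_rw [hVv] at e3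
    rw [zero_add, div_one, one_smul] at e3 e4
    rw [← e3] at e1
    have e5 : ∫ x in (0:ℝ)..1, fourier (-k) (x : UnitAddCircle) • W x
       = Complex.I * fourierCoeff w k := by
      rw [e4]
      simp only [hW, smul_eq_mul]
      simp only [mul_left_comm _ Complex.I]
      rw [intervalIntegral.integral_const_mul]
    rw [e5, ← h k] at e1
    rw [e1]
    have : (k:ℂ) ≠ 0 := by exact_mod_cast hk
    have hpi : (Real.pi:ℂ) ≠ 0 := by exact_mod_cast Real.pi_ne_zero
    have hI := Complex.I_ne_zero
    push_cast
    field_simp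
    ring
  have hz := coeff_zero (g := fun t => u t - V t) (by fun_prop) (by
    intro k hk
    have := fourierCoeff.add (f := u) (g := fun t => (-1) * V t) (cint hu) (cint (by fun_prop))
    have e : (u + fun t => (-1) * V t) = fun t => u t - V t := by
      ext t; simp [sub_eq_add_neg]
    rw [e] at this
    rw [this, Pi.add_apply, fourierCoeff.const_mul, hcoef k hk]
    ring)
  have e : (fun t : ℝ => u (t : UnitAddCircle)) = fun t => v t + fourierCoeff (fun t => u t - V t) 0 := by
    ext s
    rw [← hz (s : UnitAddCircle), hVv]; ring
  rw [e]
  exact (hvd t).add_const _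

section
variable {n : ℕ} {j0 : Fin n} {l : Fin n → ℝ} {θ c0 L B B' LH ρ : ℝ} {K : Ecn n → ℝ}
    {DK : Ecn n → Ecn n} {p : Ecn n}

theorem orbit_ex (hg : GH n j0 l θ c0 L B B' LH ρ K DK p) :
    ∃ u : ℝ → Ecn n, (∀ t, u (t + 1) = u t) ∧ 
      (∀ t, HasDerivAt u (Complex.I • (WithLp.toLp 2 (fun j => ((2 * l j : ℝ) : ℂ) * u t j) + DK (u t))) t) ∧
      ∃ t, 0 < 1 / 2 * inner ℝ (u t) (DK (u t)) - c0 - K (u t) := by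
  obtain ⟨u, hu, h1, h2⟩ := weak_sol hg
  have hDK := hg.DKc
  refine ⟨fun t => u (t : UnitAddCircle), fun t => ?_, fun t => ?_, ?_⟩
  · simp only
    rw [AddCircle.coe_add_period 1 t]
  · refine hasDerivAt_ecn (fun j => ?_)
    have := weak_deriv (u := fun t => u t j) (w := fun t => ((2 * l j : ℝ) : ℂ) * u t j + DK (u t) j)
      (by fun_prop) (by fun_prop) (by
        intro k
        have e := fourierCoeff.add (f := fun t => ((2 * l j : ℝ) : ℂ) * u t j) (g := fun t => DK (u t) j)
          (cint (by fun_prop)) (cint (by fun_prop))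
        have e' : (fun t => ((2 * l j : ℝ) : ℂ) * u t j + DK (u t) j)
          = (fun t => ((2 * l j : ℝ) : ℂ) * u t j) + (fun t => DK (u t) j) := rfl
        rw [e', e, Pi.add_apply, fourierCoeff.const_mul, ← h1 k j]
        push_cast
        ring) t
    exact this
  · by_contra hcon
    push Not at hcon
    refine absurd h2 (not_lt.2 (integral_nonpos (fun t => ?_)))
    obtain ⟨s, rfl⟩ := QuotientAddGroup.mk_surjective t
    exact hcon s
end
end Part6

section Part7
lemma K_data {n : ℕ} {K : Ecn n → ℝ} (hK : ContDiff ℝ (⊤ : ℕ∞) K) (hs : HasCompactSupport K) :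
    ∃ L B B' : ℝ, 0 ≤ L ∧ (∀ x h, |K (x + h) - K x - ⟪gradient K x, h⟫| ≤ L * ‖h‖ ^ 2) ∧
      (∀ x y, ‖gradient K x - gradient K y‖ ≤ L * ‖x - y‖) ∧ (∀ x, ‖gradient K x‖ ≤ B) ∧
      (∀ x, |K x| ≤ B') := by
  have hd : Differentiable ℝ K := hK.differentiable (by simp)
  have hf : ContDiff ℝ 1 (fderiv ℝ K) := (contDiff_infty.1 hK 2).fderiv_right (by norm_num)
  have hfs : HasCompactSupport (fderiv ℝ K) := hs.fderiv ℝ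
  obtain ⟨L, hL⟩ := hf.lipschitzWith_of_hasCompactSupport hfs (by simp)
  obtain ⟨B, hB⟩ := hf.continuous.bounded_above_of_compact_support hfs
  obtain ⟨B', hB'⟩ := hK.continuous.bounded_above_of_compact_support hs
  refine ⟨L, B, B', L.2, ?_, ?_, ?_, hB'⟩
  · intro x h
    have := (convex_ball x (‖h‖ + 1)) 
    have h1 := (convex_segment x (x + h)).norm_image_sub_le_of_norm_hasFDerivWithin_le' (f := K) (f' := fderiv ℝ K) (φ := fderiv ℝ K x) (C := L * ‖h‖)
      (fun z _ => (hd z).hasFDerivAt.hasFDerivWithinAt) (fun z hz => by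
        rw [← dist_eq_norm]
        refine (hL.dist_le_mul _ _).trans ?_
        have : dist z x ≤ ‖h‖ := by
          rw [segment_eq_image'] at hz
          obtain ⟨s, hs, rfl⟩ := hz
          rw [dist_eq_norm]
          simp only [add_sub_cancel_left, norm_smul, Real.norm_eq_abs, abs_of_nonneg hs.1]
          nlinarith [norm_nonneg h, hs.2]
        gcongr) (left_mem_segment ℝ x (x + h)) (right_mem_segment ℝ x (x + h))
    rw [add_sub_cancel_left] at h1
    rw [gradient, InnerProductSpace.toDual_symm_apply]
    rw [pow_two, ← mul_assoc]
    exact h1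
  · intro x y
    rw [gradient, gradient, ← map_sub, LinearIsometryEquiv.norm_map, ← dist_eq_norm, ← dist_eq_norm]
    exact hL.dist_le_mul _ _
  · intro x
    rw [gradient, LinearIsometryEquiv.norm_map]
    exact hB x

lemma g_ex (A a δ : ℝ) (hA : 0 < A) (hδ : 0 < δ) : ∃ g g' : ℝ → ℝ,
    ContDiff ℝ (⊤ : ℕ∞) g ∧ (∀ s, HasDerivAt g (g' s) s) ∧ (∀ s ≤ a, g s = 0 ∧ g' s = 0) ∧
    (∀ s, a < s → 0 < g s) ∧ (∃ c, ∀ s, a + δ ≤ s → g s = A * s + c) ∧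
    ∀ s, 0 ≤ s → g' s * s - g s ≤ A * (a + δ) ∨ a + δ < 0 := by
  set g' : ℝ → ℝ := fun s => A * Real.smoothTransition ((s - a) / δ) with hg'
  have hsm : ContDiff ℝ (⊤ : ℕ∞) g' := by
    refine contDiff_const.mul ?_
    exact (Real.smoothTransition.contDiff (n := (⊤ : ℕ∞))).comp (by fun_prop)
  have hc : Continuous g' := hsm.continuous
  set g : ℝ → ℝ := fun s => ∫ τ in a..s, g' τ with hg
  have hd : ∀ s, HasDerivAt g (g' s) s := fun s =>
    intervalIntegral.integral_hasDerivAt_right (hc.intervalIntegrable _ _)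
      (hc.stronglyMeasurableAtFilter _ _) hc.continuousAt
  have h0 : ∀ s ≤ a, g' s = 0 := by
    intro s hs
    simp only [hg']
    rw [Real.smoothTransition.zero_of_nonpos, mul_zero]
    exact div_nonpos_of_nonpos_of_nonneg (by linarith) hδ.le
  have h1 : ∀ s, a + δ ≤ s → g' s = A := by
    intro s hs
    simp only [hg']
    rw [Real.smoothTransition.one_of_one_le, mul_one]
    rw [le_div_iff₀ hδ]; linarith
  have hpos : ∀ s, a < s → 0 < g' s := fun s hs =>
    mul_pos hA (Real.smoothTransition.pos_of_pos (div_pos (by linarith) hδ))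
  have hgpos : ∀ s, a < s → 0 < g s := by
    intro s hs
    exact intervalIntegral.intervalIntegral_pos_of_pos_on (hc.intervalIntegrable _ _)
      (fun x hx => hpos x hx.1) hs
  have hga : ∀ s ≤ a, g s = 0 := by
    intro s hs
    simp only [hg]
    rw [intervalIntegral.integral_symm, neg_eq_zero]
    rw [intervalIntegral.integral_congr (g := fun _ => 0)]
    · simp
    · intro x hx
      rw [Set.uIcc_of_le hs] at hx
      exact h0 x hx.2
  have haff : ∀ s, a + δ ≤ s → g s = A * s + (g (a + δ) - A * (a + δ)) := by
    intro s hs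
    have e : g s = g (a + δ) + ∫ τ in (a+δ)..s, g' τ :=
      (intervalIntegral.integral_add_adjacent_intervals (hc.intervalIntegrable _ _)
        (hc.intervalIntegrable _ _)).symm
    rw [e, intervalIntegral.integral_congr (g := fun _ => A)]
    · simp; ring
    · intro x hx
      rw [Set.uIcc_of_le hs] at hx
      exact h1 x hx.1
  refine ⟨g, g', ?_, hd, fun s hs => ⟨hga s hs, h0 s hs⟩, hgpos, ⟨_, haff⟩, fun s hs => ?_⟩
  · have : ContDiff ℝ ((⊤ : ℕ∞) : WithTop ℕ∞) g := by
      rw [contDiff_infty_iff_deriv]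
      refine ⟨fun s => (hd s).differentiableAt, ?_⟩
      rw [funext (fun s => (hd s).deriv)]
      exact hsm
    exact this
  · by_cases hneg : a + δ < 0
    · exact Or.inr hneg
    · left
      have hg0 : ∀ s, 0 ≤ g s := fun s => by
        rcases le_or_gt s a with h | h
        · exact (hga s h).ge
        · exact (hgpos s h).le
      have hle : g' s ≤ A := by
        have := Real.smoothTransition.le_one ((s - a) / δ)
        simp only [hg']; nlinarith
      rcases le_or_gt (a + δ) s with h | h
      · rw [haff s h, h1 s h]
        have := hg0 (a + δ)
        linarith
      · have := hg0 s
        push Not at hneg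
        nlinarith
  
def Qf {n : ℕ} (l : Fin n → ℝ) (z : Ecn n) : ℝ := ∑ j, l j * ‖z j‖ ^ 2
def DQ {n : ℕ} (l : Fin n → ℝ) (z : Ecn n) : Ecn n := 
  WithLp.toLp 2 (fun j => ((2 * l j : ℝ) : ℂ) * z j)

lemma inner_DQ {n : ℕ} (l : Fin n → ℝ) (z h : Ecn n) :
    ⟪DQ l z, h⟫ = ∑ j, 2 * l j * inner ℝ (z j) (h j) := by
  rw [PiLp.inner_apply]
  refine Finset.sum_congr rfl (fun j _ => ?_)
  simp only [DQ]
  rw [← Complex.real_smul, real_inner_smul_left]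

lemma Qf_add {n : ℕ} (l : Fin n → ℝ) (z h : Ecn n) :
    Qf l (z + h) = Qf l z + ⟪DQ l z, h⟫ + Qf l h := by
  rw [inner_DQ, Qf, Qf, Qf, ← Finset.sum_add_distrib, ← Finset.sum_add_distrib]
  refine Finset.sum_congr rfl (fun i _ => ?_)
  rw [PiLp.add_apply, norm_add_sq_real]
  ring

lemma Qf_le {n : ℕ} (l : Fin n → ℝ) (c : ℝ) (hl : ∀ j, l j ≤ c) (h : Ecn n) :
    Qf l h ≤ c * ‖h‖ ^ 2 := by
  rw [EuclideanSpace.norm_sq_eq, Finset.mul_sum]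
  refine Finset.sum_le_sum (fun j _ => ?_)
  have := hl j
  gcongr

lemma Qf_ge {n : ℕ} (l : Fin n → ℝ) (c : ℝ) (hl : ∀ j, c ≤ l j) (h : Ecn n) :
    c * ‖h‖ ^ 2 ≤ Qf l h := by
  rw [EuclideanSpace.norm_sq_eq, Finset.mul_sum]
  refine Finset.sum_le_sum (fun j _ => ?_)
  have := hl j
  gcongr

lemma Qf_smooth {n : ℕ} (l : Fin n → ℝ) : ContDiff ℝ (⊤ : ℕ∞) (Qf l) := by
  unfold Qf
  refine ContDiff.sum (fun j _ => contDiff_const.mul ?_)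
  refine ContDiff.norm_sq ℝ ?_
  exact (EuclideanSpace.proj (𝕜 := ℂ) j : Ecn n →L[ℂ] ℂ).restrictScalars ℝ |>.contDiff

lemma Qf_smul {n : ℕ} (l : Fin n → ℝ) (s : ℝ) (z : Ecn n) : Qf l (s • z) = s ^ 2 * Qf l z := by
  rw [Qf, Qf, Finset.mul_sum]
  refine Finset.sum_congr rfl (fun j _ => ?_)
  rw [PiLp.smul_apply, norm_smul, mul_pow, Real.norm_eq_abs, sq_abs]; ring

lemma Qf_grad {n : ℕ} (l : Fin n → ℝ) (z : Ecn n) : HasGradientAt (Qf l) (DQ l z) z := by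
  have h1 : HasFDerivAt (fun w => Qf l (w - z)) (0 : Ecn n →L[ℝ] ℝ) z := by
    have hO : (fun w => Qf l (w - z)) =O[nhds z] (fun w => ‖w - z‖ ^ 2) := by
      refine Asymptotics.IsBigO.of_bound (∑ j, |l j|) (Filter.Eventually.of_forall (fun w => ?_))
      have a : ∀ j, |l j| ≤ ∑ j, |l j| := fun j =>
        Finset.single_le_sum (f := fun j => |l j|) (fun j _ => abs_nonneg _) (Finset.mem_univ j)
      rw [Real.norm_eq_abs, Real.norm_of_nonneg (by positivity), abs_le]
      constructor
      · have := Qf_ge l (-∑ j, |l j|) (fun j => by linarith [a j, neg_abs_le (l j)]) (w - z)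
        linarith
      · exact Qf_le l _ (fun j => (le_abs_self _).trans (a j)) _
    exact hO.hasFDerivAt (by norm_num)
  have h2 : HasFDerivAt (fun w => Qf l z + ⟪DQ l z, w - z⟫) (InnerProductSpace.toDual ℝ _ (DQ l z)) z := by
    have := (InnerProductSpace.toDual ℝ (Ecn n) (DQ l z)).hasFDerivAt (x := z)
    have h3 := (this.const_add (Qf l z)).sub_const (⟪DQ l z, z⟫)
    refine h3.congr_of_eventuallyEq (Filter.Eventually.of_forall (fun w => ?_))
    simp only [inner_sub_right, InnerProductSpace.toDual_apply_apply]
    ring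
  have h4 := h2.add h1
  rw [add_zero] at h4
  refine h4.congr_of_eventuallyEq (Filter.Eventually.of_forall (fun w => ?_))
  simp only [Pi.add_apply]
  rw [← Qf_add, add_sub_cancel]

lemma inner_I {n : ℕ} (v : Ecn n) : ⟪v, Complex.I • v⟫ = 0 := by
  rw [PiLp.inner_apply]
  refine Finset.sum_eq_zero (fun j _ => ?_)
  rw [cinner_def]
  simp
  ring
end Part7

section Part8
lemma hz_aux {n : ℕ} (j0 : Fin n) (F : Ecn n → ℝ) (m a δ A η ρ : ℝ) (p : Ecn n)
    (hF : ContDiff ℝ (⊤ : ℕ∞) F) (hF0 : ∀ z, 0 ≤ F z) (hFm : ∀ z, F z ≤ m) (hm : 0 < m)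
    (hρ : 0 < ρ) (hp : ∀ z, ‖z - p‖ < ρ → F z = 0)
    (ha : 0 < a) (hδ : 0 < δ) (hA1 : Real.pi < A) (hA2 : A < 2 * Real.pi) (hη : 0 < η)
    (hη1 : η ≤ 1) (hAη : A * η < Real.pi) (hAm : A * (a + δ) ≤ m)
    (hsub : ∀ z, F z < m → Qf (fun j => if j = j0 then 1 else η) z ≤ a) :
    ∃ u : ℝ → Ecn n, (∀ t, u (t + 1) = u t) ∧
      (∀ t, HasDerivAt u (Complex.I • gradient F (u t)) t) ∧ (∀ t, F (u t) < m) ∧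
      ∃ t₁ t₂, u t₁ ≠ u t₂ := by
  have hpi := Real.pi_pos
  have hA : 0 < A := hpi.trans hA1
  set w : Fin n → ℝ := fun j => if j = j0 then 1 else η with hw
  have hwη : ∀ j, η ≤ w j := by
    intro j; simp only [hw]; split_ifs <;> linarith
  obtain ⟨g, g', hgs, hgd, hga, hgpos, ⟨c, hgc⟩, hgm⟩ := g_ex A a δ hA hδ
  have hgm' : ∀ s, 0 ≤ s → g' s * s - g s ≤ m := by
    intro s hs
    rcases hgm s hs with h | h
    · linarith
    · linarith
  have hg0 : ∀ s, 0 ≤ g s := fun s => by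
    rcases le_or_gt s a with h | h
    · exact (hga s h).1.ge
    · exact (hgpos s h).le
  set l : Fin n → ℝ := fun j => A * w j with hl
  have hQl : ∀ z, Qf l z = A * Qf w z := by
    intro z
    rw [Qf, Qf, Finset.mul_sum]
    exact Finset.sum_congr rfl (fun j _ => by simp only [hl]; ring)
  have hDQl : ∀ z, DQ l z = A • DQ w z := by
    intro z
    ext j
    simp only [DQ, hl, PiLp.smul_apply, Complex.real_smul]
    push_cast; ring
  have hq0 : ∀ z, 0 ≤ Qf w z := fun z => by
    have := Qf_ge w η hwη z
    have : 0 ≤ η * ‖z‖ ^ 2 := by positivity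
    linarith
  set c0 : ℝ := m + c with hc0
  set K : Ecn n → ℝ := fun z => F z + g (Qf w z) - Qf l z - c0 with hKdef
  have hKs : ContDiff ℝ (⊤ : ℕ∞) K :=
    ((hF.add (hgs.comp (Qf_smooth w))).sub (Qf_smooth l)).sub contDiff_const
  have hFeq : ∀ z, a < Qf w z → F z = m := by
    intro z hz
    by_contra h
    exact absurd (hsub z (lt_of_le_of_ne (hFm z) h)) (not_le.2 hz)
  have hKc : HasCompactSupport K := by
    refine HasCompactSupport.intro (isCompact_closedBall (0 : Ecn n) (Real.sqrt ((a + δ) / η)))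
      (fun z hz => ?_)
    have h1 : a + δ ≤ Qf w z := by
      rw [mem_closedBall_zero_iff, not_le, Real.sqrt_lt' (by
        by_contra h
        have h2 : ‖z‖ = 0 := le_antisymm (not_lt.1 h) (norm_nonneg z)
        exact absurd ((Real.sqrt_nonneg _).trans_lt hz) h), div_lt_iff₀ hη] at hz
      have := Qf_ge w η hwη z
      linarith
    simp only [hKdef]
    rw [hFeq z (by linarith), hgc _ h1, hQl]
    ring
  obtain ⟨L, B, B', hL, hK1, hK2, hK3, hK4⟩ := K_data hKs hKc
  set H : Ecn n → ℝ := fun z => Qf l z + c0 + K z with hH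
  have hHe : ∀ z, H z = F z + g (Qf w z) := by
    intro z; simp only [hH, hKdef]; ring
  set DH : Ecn n → Ecn n := fun z => DQ l z + gradient K z with hDH
  have hKd : Differentiable ℝ K := hKs.differentiable (by simp)
  have hFd : Differentiable ℝ F := hF.differentiable (by simp)
  have hHg : ∀ z, HasFDerivAt H (InnerProductSpace.toDual ℝ _ (DH z)) z := by
    intro z
    have h1 := ((Qf_grad l z).hasFDerivAt.add_const c0).add (hKd z).hasGradientAt.hasFDerivAt
    rw [← map_add] at h1
    exact h1
  have hDHe : ∀ z, DH z = gradient F z + g' (Qf w z) • DQ w z := by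
    intro z
    have h1 := ((hgd (Qf w z)).comp_hasFDerivAt z (Qf_grad w z).hasFDerivAt)
    have h2 := (hFd z).hasGradientAt.hasFDerivAt.add h1
    have h3 : HasFDerivAt H _ z := h2.congr_of_eventuallyEq
      (Filter.Eventually.of_forall (fun y => hHe y))
    have h4 := (hHg z).unique h3
    refine (InnerProductSpace.toDual ℝ (Ecn n)).injective ?_
    rw [h4, map_add, map_smul]
  have hHp : ∀ z, ‖z - p‖ < ρ → H z = 0 := by
    intro z hz
    have h0 := hp z hz
    rw [hHe, h0, (hga _ (hsub z (by rw [h0]; exact hm))).1, add_zero]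
  have hDHp : ∀ z, ‖z - p‖ < ρ → DH z = 0 := by
    intro z hz
    have hev : H =ᶠ[nhds z] (fun _ => (0:ℝ)) := by
      have : ball p ρ ∈ nhds z := isOpen_ball.mem_nhds (by rw [mem_ball, dist_eq_norm]; exact hz)
      filter_upwards [this] with y hy
      rw [mem_ball, dist_eq_norm] at hy
      exact hHp y hy
    have h1 : HasFDerivAt H (0 : Ecn n →L[ℝ] ℝ) z := (hasFDerivAt_const (0:ℝ) z).congr_of_eventuallyEq hev
    have h4 := (hHg z).unique h1
    simpa using h4
  set θ : ℝ := min (min (A - Real.pi) (2 * Real.pi - A)) (min (A * η) (Real.pi - A * η)) with hθ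
  have hAη0 : 0 < A * η := by positivity
  have hθ0 : 0 < θ := by
    simp only [hθ, lt_min_iff]
    refine ⟨⟨?_, ?_⟩, ?_, ?_⟩ <;> linarith
  have t1 : θ ≤ A - Real.pi := (min_le_left _ _).trans (min_le_left _ _)
  have t2 : θ ≤ 2 * Real.pi - A := (min_le_left _ _).trans (min_le_right _ _)
  have t3 : θ ≤ A * η := (min_le_right _ _).trans (min_le_left _ _)
  have t4 : θ ≤ Real.pi - A * η := (min_le_right _ _).trans (min_le_right _ _)
  have hGH : GH n j0 l θ c0 L B B' (A + L) ρ K (gradient K) p := by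
    refine ⟨hθ0, ?_, ?_, ?_, hKs.continuous, ?_, hL, hK1, hK2, hK3, hK4, ?_, by linarith, hρ, ?_⟩
    · intro k j
      rw [le_abs]
      simp only [hl, hw]
      split_ifs with h
      · rcases le_or_gt k 1 with hk | hk
        · right
          have : (k:ℝ) ≤ 1 := by exact_mod_cast hk
          nlinarith
        · left
          have : (2:ℝ) ≤ k := by exact_mod_cast hk
          nlinarith
      · rcases le_or_gt k 0 with hk | hk
        · right
          have : (k:ℝ) ≤ 0 := by exact_mod_cast hk
          nlinarith
        · left
          have : (1:ℝ) ≤ k := by exact_mod_cast hk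
          nlinarith
    · intro j
      have : A * η ≤ A * w j := by have := hwη j; gcongr
      simp only [hl]
      linarith
    · simp only [hl, hw, if_true]; linarith
    · have : LipschitzWith ⟨L, hL⟩ (gradient K) := by
        refine LipschitzWith.of_dist_le_mul (fun x y => ?_)
        rw [dist_eq_norm, dist_eq_norm]; exact hK2 x y
      exact this.continuous
    · intro z
      have : 0 ≤ H z := by rw [hHe]; linarith [hF0 z, hg0 (Qf w z)]
      exact this
    · intro z hz h
      change H (z + h) ≤ _
      have e1 := hHp z hz
      have e2 := hDHp z hz
      have e3 := (abs_le.1 (hK1 z h)).2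
      have e4 := Qf_add l z h
      have e5 := Qf_le l A (fun j => by
        have : w j ≤ 1 := by simp only [hw]; split_ifs <;> linarith
        simp only [hl]; nlinarith) h
      have e6 : ⟪DQ l z, h⟫ + ⟪gradient K z, h⟫ = 0 := by
        rw [← inner_add_left]
        change ⟪DH z, h⟫ = 0
        rw [e2, inner_zero_left]
      simp only [hH] at e1 ⊢
      nlinarith
  obtain ⟨u, hu1, hu2, t, ht⟩ := orbit_ex hGH
  have hu3 : ∀ t, HasDerivAt u (Complex.I • DH (u t)) t := hu2
  -- action in terms of H
  have hact : 0 < 1 / 2 * ⟪u t, DH (u t)⟫ - H (u t) := by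
    have e1 : ⟪u t, DQ l (u t)⟫ = 2 * Qf l (u t) := by
      rw [real_inner_comm, inner_DQ, Qf, Finset.mul_sum]
      refine Finset.sum_congr rfl (fun j _ => ?_)
      rw [real_inner_self_eq_norm_sq]; ring
    simp only [hDH, hH, inner_add_right]
    rw [e1]
    linarith
  have hact2 : 0 < 1 / 2 * ⟪u t, gradient F (u t)⟫ + g' (Qf w (u t)) * Qf w (u t) - F (u t)
      - g (Qf w (u t)) := by
    have e1 : ⟪u t, DQ w (u t)⟫ = 2 * Qf w (u t) := by
      rw [real_inner_comm, inner_DQ, Qf, Finset.mul_sum]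
      refine Finset.sum_congr rfl (fun j _ => ?_)
      rw [real_inner_self_eq_norm_sq]; ring
    rw [hDHe, hHe, inner_add_right, inner_smul_right, e1] at hact
    linarith
  -- gradient vanishes at max
  have hgz : ∀ z, F z = m → gradient F z = 0 := by
    intro z hz
    have : IsLocalMax F z := Filter.Eventually.of_forall (fun y => by rw [hz]; exact hFm y)
    rw [gradient, this.fderiv_eq_zero, map_zero]
  have hta : Qf w (u t) ≤ a := by
    by_contra h
    push Not at h
    have e := hFeq _ h
    rw [hgz _ e, inner_zero_right, e] at hact2
    have := hgm' _ (hq0 (u t))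
    linarith
  have hFt : F (u t) < m := by
    refine lt_of_le_of_ne (hFm _) (fun e => ?_)
    rw [hgz _ e, inner_zero_right, (hga _ hta).1, (hga _ hta).2] at hact2
    linarith
  have hcons : ∀ s, H (u s) = H (u t) := by
    have hd : ∀ s, HasDerivAt (fun s => H (u s)) 0 s := by
      intro s
      have := (hHg (u s)).comp_hasDerivAt s (hu3 s)
      rw [InnerProductSpace.toDual_apply_apply, inner_I] at this
      exact this
    intro s
    exact is_const_of_deriv_eq_zero (fun s => (hd s).differentiableAt) (fun s => (hd s).deriv) s t
  have hHt : H (u t) < m := by rw [hHe, (hga _ hta).1]; linarith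
  have hqa : ∀ s, Qf w (u s) ≤ a := by
    intro s
    by_contra h
    push Not at h
    have e := hcons s
    rw [hHe, hFeq _ h] at e
    have := hgpos _ h
    linarith
  have hDHF : ∀ s, DH (u s) = gradient F (u s) := by
    intro s
    rw [hDHe, (hga _ (hqa s)).2, zero_smul, add_zero]
  refine ⟨u, hu1, fun s => by rw [← hDHF]; exact hu3 s, fun s => ?_, ?_⟩
  · have e := hcons s
    rw [hHe, (hga _ (hqa s)).1] at e
    linarith
  · by_contra hcon
    push Not at hcon
    have h1 : HasDerivAt u 0 t := by
      have : u = fun _ => u t := funext (fun s => hcon s t)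
      rw [this]
      exact hasDerivAt_const t (u t)
    have h2 := (hu3 t).unique h1
    have h3 : gradient F (u t) = 0 := by
      rw [← hDHF]
      simpa using h2
    rw [h3, inner_zero_right, (hga _ hta).1, (hga _ hta).2] at hact2
    linarith [hF0 (u t)]

theorem hz {n : ℕ} (j0 : Fin n) (F : Ecn n → ℝ) (m a0 R ρ : ℝ) (p : Ecn n)
    (hF : ContDiff ℝ (⊤ : ℕ∞) F) (hF0 : ∀ z, 0 ≤ F z) (hFm : ∀ z, F z ≤ m)
    (hρ : 0 < ρ) (hp : ∀ z, ‖z - p‖ < ρ → F z = 0)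
    (ha : 0 ≤ a0) (hm : Real.pi * a0 < m)
    (hsub : ∀ z, F z < m → ‖z j0‖ ^ 2 ≤ a0 ∧ ‖z‖ ≤ R) :
    ∃ u : ℝ → Ecn n, (∀ t, u (t + 1) = u t) ∧
      (∀ t, HasDerivAt u (Complex.I • gradient F (u t)) t) ∧ (∀ t, F (u t) < m) ∧
      ∃ t₁ t₂, u t₁ ≠ u t₂ := by
  have hpi := Real.pi_pos
  have hm0 : 0 < m := lt_of_le_of_lt (by positivity) hm
  set δ : ℝ := (m / Real.pi - a0) / 3 with hδ
  have hδ0 : 0 < δ := by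
    have : a0 < m / Real.pi := by rw [lt_div_iff₀ hpi]; linarith
    simp only [hδ]; linarith
  have hmd : m = Real.pi * (a0 + 3 * δ) := by simp only [hδ]; field_simp; ring
  set a := a0 + δ with haa
  have ha1 : 0 < a + δ := by linarith
  set A := min (m / (a + δ)) (3 / 2 * Real.pi) with hA
  have hA1 : Real.pi < A := by
    rw [hA, lt_min_iff]
    refine ⟨?_, by linarith⟩
    rw [lt_div_iff₀ ha1, hmd, haa]
    nlinarith
  have hA2 : A ≤ 3 / 2 * Real.pi := min_le_right _ _
  have hA3 : A * (a + δ) ≤ m := by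
    rw [← le_div_iff₀ ha1]; exact min_le_left _ _
  set η := min (1 / 2) (δ / (R ^ 2 + 1)) with hη
  have hη0 : 0 < η := by rw [hη, lt_min_iff]; exact ⟨by norm_num, by positivity⟩
  have hη1 : η ≤ 1 / 2 := min_le_left _ _
  have hη2 : η * (R ^ 2 + 1) ≤ δ := by
    rw [← le_div_iff₀ (by positivity)]; exact min_le_right _ _
  refine hz_aux j0 F m a δ A η ρ p hF hF0 hFm hm0 hρ hp (by linarith) hδ0 hA1 (by linarith) hη0
    (by linarith) (by nlinarith) hA3 ?_
  intro z hz
  obtain ⟨h1, h2⟩ := hsub z hz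
  have h3 : Qf (fun j => if j = j0 then 1 else η) z ≤ ‖z j0‖ ^ 2 + η * ‖z‖ ^ 2 := by
    rw [EuclideanSpace.norm_sq_eq, Finset.mul_sum, Qf]
    have e : ‖z j0‖ ^ 2 = ∑ j, if j = j0 then ‖z j‖ ^ 2 else 0 := by simp
    rw [e, ← Finset.sum_add_distrib]
    refine Finset.sum_le_sum (fun j _ => ?_)
    have : 0 ≤ η * ‖z j‖ ^ 2 := by positivity
    split_ifs <;> linarith
  have h4 : ‖z‖ ^ 2 ≤ R ^ 2 := by gcongr
  nlinarith
end Part8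

section Part9
section Upper
variable {Z : Type*} [NormedAddCommGroup Z] [InnerProductSpace ℝ Z] [CompleteSpace Z]

def extf (O : Set Z) (m : ℝ) (f : Z → ℝ) (z : Z) : ℝ :=
  open Classical in if z ∈ O then f z else m

lemma extf_in {O : Set Z} {m : ℝ} {f : Z → ℝ} {z : Z} (h : z ∈ O) : extf O m f z = f z := by
  simp [extf, h]

lemma extf_out {O : Set Z} {m : ℝ} {f : Z → ℝ} {z : Z} (h : z ∉ O) : extf O m f z = m := by
  simp [extf, h]

lemma cross {O : Set Z} (hO : IsOpen O) {y z : Z} (hy : y ∈ O) (hz : z ∉ O) :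
    ∃ w ∈ segment ℝ y z, w ∈ frontier O := by
  by_contra! hc
  have hp := (convex_segment (𝕜 := ℝ) y z).isPreconnected
  have key : ∀ w ∈ segment ℝ y z, w ∈ O ∪ (closure O)ᶜ := by
    intro w hw
    by_contra h
    simp only [Set.mem_union, Set.mem_compl_iff, not_or, not_not] at h
    refine hc w hw ?_
    rw [hO.frontier_eq]
    exact ⟨h.2, h.1⟩
  obtain ⟨w, hw, hw1, hw2⟩ := hp O (closure O)ᶜ hO isClosed_closure.isOpen_compl key
    ⟨y, left_mem_segment ℝ y z, hy⟩
    ⟨z, right_mem_segment ℝ y z, (key z (right_mem_segment ℝ y z)).resolve_left hz⟩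
  exact hw2 (subset_closure hw1)

lemma extf_smooth {O : Set Z} (hO : IsOpen O) {m : ℝ} {f : Z → ℝ} (hf : IsAdmissible O m f) :
    ContDiff ℝ (⊤ : ℕ∞) (extf O m f) := by
  obtain ⟨hm, hs, hb, hU, hfr, hbd, d, hd, hdist⟩ := hf
  rw [contDiff_iff_contDiffAt]
  intro z
  by_cases hz : z ∈ O
  · refine (hs.contDiffAt (hO.mem_nhds hz)).congr_of_eventuallyEq ?_
    filter_upwards [hO.mem_nhds hz] with y hy
    exact extf_in hy
  · refine (contDiffAt_const (c := m)).congr_of_eventuallyEq ?_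
    filter_upwards [ball_mem_nhds z hd] with y hy
    by_cases hyO : y ∈ O
    · rw [extf_in hyO]
      by_contra hne
      have hlt := lt_of_le_of_ne (hb y hyO).2 hne
      obtain ⟨w, hw, hwf⟩ := cross hO hyO hz
      have h1 := hdist y ⟨hyO, hlt⟩ w hwf
      have h2 : w ∈ ball y d := (convex_ball y d).segment_subset (mem_ball_self hd)
        (mem_ball_comm.1 hy) hw
      rw [mem_ball, dist_comm] at h2
      linarith
    · exact extf_out hyO

def Tl (b : ℕ × Bool → Z) (n : ℕ) : Ecn n →ₗ[ℝ] Z where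
  toFun z := ∑ j : Fin n, ((z j).re • b (j, true) - (z j).im • b (j, false))
  map_add' x y := by
    rw [← Finset.sum_add_distrib]
    refine Finset.sum_congr rfl (fun j _ => ?_)
    simp only [PiLp.add_apply, Complex.add_re, Complex.add_im, add_smul]
    abel
  map_smul' c x := by
    rw [Finset.smul_sum]
    refine Finset.sum_congr rfl (fun j _ => ?_)
    simp [smul_sub, smul_smul]

def T (b : ℕ × Bool → Z) (n : ℕ) : Ecn n →L[ℝ] Z := LinearMap.toContinuousLinearMap (Tl b n)

def S (b : ℕ × Bool → Z) (n : ℕ) (v : Z) : Ecn n :=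
  WithLp.toLp 2 (fun j : Fin n => (⟨⟪b (j, true), v⟫, -⟪b (j, false), v⟫⟩ : ℂ))

lemma T_apply (b : ℕ × Bool → Z) (n : ℕ) (z : Ecn n) :
    T b n z = ∑ j : Fin n, ((z j).re • b (j, true) - (z j).im • b (j, false)) := rfl

lemma T_S (b : ℕ × Bool → Z) (n : ℕ) (v : Z) : T b n (S b n v) = proj b n v := by
  rw [T_apply, proj, ← Fin.sum_univ_eq_sum_range
    (fun j => ⟪b (j, true), v⟫ • b (j, true) + ⟪b (j, false), v⟫ • b (j, false)) n]
  refine Finset.sum_congr rfl (fun j _ => ?_)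
  simp [S]

lemma T_adj (b : ℕ × Bool → Z) (n : ℕ) (v : Z) (z : Ecn n) : ⟪v, T b n z⟫ = ⟪S b n v, z⟫ := by
  rw [T_apply, inner_sum, PiLp.inner_apply]
  refine Finset.sum_congr rfl (fun j _ => ?_)
  rw [cinner_def, inner_sub_right, real_inner_smul_right, real_inner_smul_right]
  simp only [S, Complex.mul_re, Complex.conj_re, Complex.conj_im]
  rw [real_inner_comm v, real_inner_comm v]
  ring

lemma S_T {b : ℕ × Bool → Z} (hb : Orthonormal ℝ b) (n : ℕ) (z : Ecn n) : S b n (T b n z) = z := by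
  have hb' := orthonormal_iff_ite.1 hb
  ext j
  have h1 : ⟪b (j, true), T b n z⟫ = (z j).re := by
    rw [T_apply, inner_sum, Finset.sum_eq_single j]
    · rw [inner_sub_right, real_inner_smul_right, real_inner_smul_right, hb', hb']; simp
    · intro i _ hi
      rw [inner_sub_right, real_inner_smul_right, real_inner_smul_right, hb', hb']
      have : (j : ℕ) ≠ i := fun h => hi (Fin.ext h.symm)
      simp [this]
    · simp
  have h2 : ⟪b (j, false), T b n z⟫ = -(z j).im := by
    rw [T_apply, inner_sum, Finset.sum_eq_single j]
    · rw [inner_sub_right, real_inner_smul_right, real_inner_smul_right, hb', hb']; simp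
    · intro i _ hi
      rw [inner_sub_right, real_inner_smul_right, real_inner_smul_right, hb', hb']
      have : (j : ℕ) ≠ i := fun h => hi (Fin.ext h.symm)
      simp [this]
    · simp
  simp only [S]
  rw [h1, h2]
  simp

lemma T_norm {b : ℕ × Bool → Z} (hb : Orthonormal ℝ b) (n : ℕ) (z : Ecn n) :
    ‖T b n z‖ = ‖z‖ := by
  have := T_adj b n (T b n z) z
  rw [S_T hb, real_inner_self_eq_norm_sq, real_inner_self_eq_norm_sq] at this
  exact (sq_eq_sq₀ (norm_nonneg _) (norm_nonneg _)).1 this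

lemma T_J {b : ℕ × Bool → Z} {J : Z →L[ℝ] Z} (hJ : IsJ b J) (n : ℕ) (z : Ecn n) :
    J (T b n z) = T b n (Complex.I • z) := by
  rw [T_apply, T_apply, map_sum]
  refine Finset.sum_congr rfl (fun j _ => ?_)
  rw [map_sub, map_smul, map_smul, (hJ j).1, (hJ j).2]
  simp
  abel

lemma proj_T {b : ℕ × Bool → Z} (hb : Orthonormal ℝ b) (n : ℕ) (z : Ecn n) :
    proj b n (T b n z) = T b n z := by
  rw [← T_S, S_T hb]

lemma proj_add (b : ℕ × Bool → Z) (n : ℕ) (x y : Z) :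
    proj b n (x + y) = proj b n x + proj b n y := by
  simp only [proj, inner_add_right, add_smul, ← Finset.sum_add_distrib]
  refine Finset.sum_congr rfl (fun j _ => ?_)
  abel

lemma proj_smul (b : ℕ × Bool → Z) (n : ℕ) (c : ℝ) (x : Z) :
    proj b n (c • x) = c • proj b n x := by
  simp only [proj, inner_smul_right, Finset.smul_sum, smul_add, smul_smul]

lemma proj_span {b : ℕ × Bool → Z} (hb : Orthonormal ℝ b) {y : Z}
    (hy : y ∈ Submodule.span ℝ (Set.range b)) : ∃ N, ∀ n ≥ N, proj b n y = y := by
  have hb' := orthonormal_iff_ite.1 hb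
  induction hy using Submodule.span_induction with
  | mem x h =>
    obtain ⟨⟨j, s⟩, rfl⟩ := h
    refine ⟨j + 1, fun n hn => ?_⟩
    rw [proj, Finset.sum_eq_single j]
    · cases s <;> rw [hb', hb'] <;> simp
    · intro i _ hi
      rw [hb', hb']
      simp [hi]
    · intro h
      exact absurd (Finset.mem_range.2 (by omega)) h
  | zero => exact ⟨0, fun n _ => by simp [proj]⟩
  | add x y _ _ hx hy =>
    obtain ⟨N, hN⟩ := hx
    obtain ⟨M, hM⟩ := hy
    refine ⟨max N M, fun n hn => ?_⟩
    rw [proj_add, hN n (le_of_max_le_left hn), hM n (le_of_max_le_right hn)]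
  | smul a x _ hx =>
    obtain ⟨N, hN⟩ := hx
    exact ⟨N, fun n hn => by rw [proj_smul, hN n hn]⟩

theorem upper {b : ℕ × Bool → Z} {J : Z →L[ℝ] Z} (hb : IsHilbertBasis b) (hJ : IsJ b J)
    {O : Set Z} (hO : IsOpen O) (j0 : ℕ) (a0 : ℝ) (ha : 0 ≤ a0)
    (hsub : ∀ z ∈ O, ⟪b (j0, true), z⟫ ^ 2 + ⟪b (j0, false), z⟫ ^ 2 ≤ a0)
    {m : ℝ} {f : Z → ℝ} (hm : Real.pi * a0 < m) (hf : IsAdmissible O m f) :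
    IsFastFunction b J O f := by
  have hsm := extf_smooth hO hf
  obtain ⟨hm0, hs, hbd, ⟨U, hUo, hUn, hUO, hU0⟩, hfr, hbdd, -⟩ := hf
  have hdense : Dense (Submodule.span ℝ (Set.range b) : Set Z) :=
    Submodule.dense_iff_topologicalClosure_eq_top.2 hb.2
  obtain ⟨y, hyU, hys⟩ := hdense.inter_open_nonempty U hUo hUn
  obtain ⟨N, hN⟩ := proj_span hb.1 hys
  obtain ⟨ρ, hρ, hball⟩ := Metric.isOpen_iff.1 hUo y hyU
  obtain ⟨R, hR⟩ := hbdd.exists_norm_le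
  have hlt : ∀ z, extf O m f z < m → z ∈ O ∧ f z < m := by
    intro z h
    by_cases hz : z ∈ O
    · rw [extf_in hz] at h; exact ⟨hz, h⟩
    · rw [extf_out hz] at h; exact absurd h (lt_irrefl _)
  refine ⟨max N (j0 + 1), fun n hn => ?_⟩
  have hj0 : j0 < n := by have := le_of_max_le_right hn; omega
  have hpy : T b n (S b n y) = y := by rw [T_S, hN n (le_of_max_le_left hn)]
  obtain ⟨u, hper, hder, hul, t₁, t₂, hne⟩ := hz (⟨j0, hj0⟩ : Fin n) (fun z => extf O m f (T b n z)) m a0 R ρ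
    (S b n y) (hsm.comp (T b n).contDiff)
    (fun z => by
      by_cases h : T b n z ∈ O
      · rw [extf_in h]; exact (hbd _ h).1
      · rw [extf_out h]; exact hm0.le)
    (fun z => by
      by_cases h : T b n z ∈ O
      · rw [extf_in h]; exact (hbd _ h).2
      · rw [extf_out h]) hρ
    (fun z hz => by
      have h1 : T b n z ∈ U := hball (by
        rw [mem_ball, dist_eq_norm, ← hpy, ← map_sub, T_norm hb.1]; exact hz)
      rw [extf_in (hUO h1), hU0 _ h1]) ha hm
    (fun z hz => by
      obtain ⟨h1, h2⟩ := hlt _ hz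
      refine ⟨?_, ?_⟩
      · have h3 := hsub _ h1
        have h4 : z ⟨j0, hj0⟩ = (S b n (T b n z)) ⟨j0, hj0⟩ := by rw [S_T hb.1]
        rw [h4, ← Complex.normSq_eq_norm_sq, Complex.normSq_apply]
        simp only [S]
        nlinarith
      · rw [← T_norm hb.1]; exact hR _ ⟨h1, h2⟩)
  refine ⟨fun t => T b n (u t), ⟨fun t => (hlt _ (hul t)).1, fun t => proj_T hb.1 n _, fun t => ?_⟩,
    ⟨t₁, t₂, fun h => hne ?_⟩, 1, one_pos, le_rfl, fun t => congrArg (T b n) (hper t)⟩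
  · have hz := (hlt _ (hul t)).1
    set z := T b n (u t) with hzdef
    have hd : HasFDerivAt (extf O m f) (fderiv ℝ f z) z := by
      have h1 : DifferentiableAt ℝ f z := (hs.contDiffAt (hO.mem_nhds hz)).differentiableAt (by simp)
      refine h1.hasFDerivAt.congr_of_eventuallyEq ?_
      filter_upwards [hO.mem_nhds hz] with y hy
      exact extf_in hy
    have hg : HasGradientAt (fun z => extf O m f (T b n z)) (S b n (gradient f z)) (u t) := by
      rw [hasGradientAt_iff_hasFDerivAt]
      have h2 := HasFDerivAt.comp (u t) (f := T b n) (g := extf O m f) hd (T b n).hasFDerivAt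
      refine h2.congr_fderiv ?_
      ext w
      rw [InnerProductSpace.toDual_apply_apply, ← T_adj, gradient,
        InnerProductSpace.toDual_symm_apply]
      rfl
    have h3 := hder t
    rw [hg.gradient] at h3
    have h4 := (T b n).hasFDerivAt.comp_hasDerivAt t h3
    rw [← T_J hJ, T_S] at h4
    exact h4
  · rw [← S_T hb.1 n (u t₁), ← S_T hb.1 n (u t₂)]
    exact congrArg (S b n) h

end Upper
end Part9

section Part10
lemma h_ex (m R : ℝ) (hm : 0 < m) (hmR : m < Real.pi * R) : ∃ (δ : ℝ) (h h' : ℝ → ℝ),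
    0 < δ ∧ δ < R ∧
    ContDiff ℝ (⊤ : ℕ∞) h ∧ (∀ s, HasDerivAt h (h' s) s) ∧ (∀ s, |h' s| < Real.pi) ∧
    (∀ s ≤ δ, h s = 0) ∧ (∀ s, R - δ ≤ s → h s = m) ∧ (∀ s, 0 ≤ h s ∧ h s ≤ m) := by
  have hpi := Real.pi_pos
  set δ : ℝ := (R - m / Real.pi) / 8 with hδ
  have hmp : m / Real.pi < R := by rw [div_lt_iff₀ hpi]; linarith
  have hmp0 : 0 < m / Real.pi := div_pos hm hpi
  have hδ0 : 0 < δ := by rw [hδ]; linarith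
  have hδR : 8 * δ < R := by rw [hδ]; linarith
  have hML : m < Real.pi * (R - 4 * δ) := by
    have : m / Real.pi < R - 4 * δ := by rw [hδ]; linarith
    rw [div_lt_iff₀ hpi] at this; linarith
  set ψ : ℝ → ℝ := fun s => Real.smoothTransition ((s - δ) / δ) *
    Real.smoothTransition ((R - δ - s) / δ) with hψ
  have hsm : ContDiff ℝ (⊤ : ℕ∞) ψ := by
    refine ContDiff.mul ?_ ?_ <;>
    exact (Real.smoothTransition.contDiff (n := (⊤ : ℕ∞))).comp (by fun_prop)
  have hc : Continuous ψ := hsm.continuous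
  have hψ0 : ∀ s, 0 ≤ ψ s := fun s => 
    mul_nonneg (Real.smoothTransition.nonneg _) (Real.smoothTransition.nonneg _)
  have hψ1 : ∀ s, ψ s ≤ 1 := fun s => 
    mul_le_one₀ (Real.smoothTransition.le_one _) (Real.smoothTransition.nonneg _)
      (Real.smoothTransition.le_one _)
  have hz1 : ∀ s ≤ δ, ψ s = 0 := by
    intro s hs
    simp only [hψ]
    rw [Real.smoothTransition.zero_of_nonpos, zero_mul]
    exact div_nonpos_of_nonpos_of_nonneg (by linarith) hδ0.le
  have hz2 : ∀ s, R - δ ≤ s → ψ s = 0 := by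
    intro s hs
    simp only [hψ]
    rw [Real.smoothTransition.zero_of_nonpos (x := (R - δ - s) / δ), mul_zero]
    exact div_nonpos_of_nonpos_of_nonneg (by linarith) hδ0.le
  have h1 : ∀ s, 2 * δ ≤ s → s ≤ R - 2 * δ → ψ s = 1 := by
    intro s hs hs'
    simp only [hψ]
    rw [Real.smoothTransition.one_of_one_le, Real.smoothTransition.one_of_one_le, mul_one]
    · rw [le_div_iff₀ hδ0]; linarith
    · rw [le_div_iff₀ hδ0]; linarith
  set g : ℝ → ℝ := fun s => ∫ τ in δ..s, ψ τ with hg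
  have hd : ∀ s, HasDerivAt g (ψ s) s := fun s =>
    intervalIntegral.integral_hasDerivAt_right (hc.intervalIntegrable _ _)
      (hc.stronglyMeasurableAtFilter _ _) hc.continuousAt
  have hadd : ∀ x y, g y = g x + ∫ τ in x..y, ψ τ := fun x y => 
      (intervalIntegral.integral_add_adjacent_intervals (hc.intervalIntegrable _ _)
        (hc.intervalIntegrable _ _)).symm
  have hmono : Monotone g := by
    intro x y hxy
    rw [hadd x y]
    have := intervalIntegral.integral_nonneg (μ := MeasureTheory.volume) hxy (fun u _ => hψ0 u)
    linarith
  have hg0 : ∀ s ≤ δ, g s = 0 := by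
    intro s hs
    simp only [hg]
    rw [intervalIntegral.integral_symm, neg_eq_zero]
    rw [intervalIntegral.integral_congr (g := fun _ => 0)]
    · simp
    · intro x hx
      rw [Set.uIcc_of_le hs] at hx
      exact hz1 x hx.2
  set M := g (R - δ) with hM
  have hgM : ∀ s, R - δ ≤ s → g s = M := by
    intro s hs
    rw [hadd (R - δ) s, intervalIntegral.integral_congr (g := fun _ => 0)]
    · simp [hM]
    · intro x hx
      rw [Set.uIcc_of_le hs] at hx
      exact hz2 x hx.1
  have hMge : R - 4 * δ ≤ M := by
    have e : g (R - 2 * δ) = g (2 * δ) + (R - 4 * δ) := by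
      rw [hadd (2 * δ) (R - 2 * δ), intervalIntegral.integral_congr (g := fun _ => 1)]
      · simp; ring
      · intro x hx
        rw [Set.uIcc_of_le (by linarith)] at hx
        exact h1 x hx.1 hx.2
    have e1 : g (R - 2 * δ) ≤ M := hmono (by linarith)
    have e2 : g δ ≤ g (2 * δ) := hmono (by linarith)
    rw [hg0 δ le_rfl] at e2
    linarith
  have hM0 : 0 < M := by linarith
  have hkpi : m / M < Real.pi := by
    rw [div_lt_iff₀ hM0]
    nlinarith
  have hk0 : 0 < m / M := div_pos hm hM0
  refine ⟨δ, fun s => m / M * g s, fun s => m / M * ψ s, hδ0, by linarith, ?_,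
    fun s => (hd s).const_mul _, fun s => ?_, fun s hs => by simp [hg0 s hs],
    fun s hs => by simp only [hgM s hs]; field_simp, fun s => ⟨?_, ?_⟩⟩
  · refine contDiff_const.mul ?_
    have : ContDiff ℝ ((⊤ : ℕ∞) : WithTop ℕ∞) g := by
      rw [contDiff_infty_iff_deriv]
      refine ⟨fun s => (hd s).differentiableAt, ?_⟩
      rw [funext (fun s => (hd s).deriv)]
      exact hsm
    exact this
  · rw [abs_of_nonneg (mul_nonneg hk0.le (hψ0 s))]
    nlinarith [hψ0 s, hψ1 s]
  · refine mul_nonneg hk0.le ?_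
    rcases le_total s δ with h | h
    · exact (hg0 s h).ge
    · rw [← hg0 δ le_rfl]; exact hmono h
  · have : g s ≤ M := by
      rcases le_total s (R - δ) with h | h
      · exact hmono h
      · exact (hgM s h).le
    calc m / M * g s ≤ m / M * M := by gcongr
      _ = m := by field_simp

section Lower
variable {Z : Type*} [NormedAddCommGroup Z] [InnerProductSpace ℝ Z] [CompleteSpace Z]

lemma JJ {b : ℕ × Bool → Z} {J : Z →L[ℝ] Z} (hJ : IsJ b J) (n : ℕ) (z : Z) (hz : proj b n z = z) :
    J (J z) = -z := by
  rw [← hz, ← T_S, T_J hJ, T_J hJ, ← map_neg]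
  congr 1
  rw [smul_smul, Complex.I_mul_I]; simp

lemma inner_J {b : ℕ × Bool → Z} {J : Z →L[ℝ] Z} (hb : Orthonormal ℝ b) (hJ : IsJ b J) (n : ℕ)
    (z : Z) (hz : proj b n z = z) : ⟪z, J z⟫ = 0 := by
  rw [← hz, ← T_S, T_J hJ, T_adj, S_T hb, inner_I]

lemma not_fast {b : ℕ × Bool → Z} {J : Z →L[ℝ] Z} (hb : Orthonormal ℝ b) (hJ : IsJ b J)
    (O : Set Z) (h h' : ℝ → ℝ) (hd : ∀ s, HasDerivAt h (h' s) s) (hpi : ∀ s, |h' s| < Real.pi)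
    (n : ℕ) (z : ℝ → Z) : ¬ IsFastTrajectory b J O (fun z => h (‖z‖ ^ 2)) n z := by
  rintro ⟨⟨-, hpr, hder⟩, ⟨t₁, t₂, hne⟩, P, hP0, hP1, hper⟩
  have hgrad : ∀ x : Z, gradient (fun z => h (‖z‖ ^ 2)) x = (2 * h' (‖x‖ ^ 2)) • x := by
    intro x
    refine HasGradientAt.gradient ?_
    rw [hasGradientAt_iff_hasFDerivAt]
    have h1 := (hasStrictFDerivAt_norm_sq x).hasFDerivAt
    have h2 := (hd (‖x‖ ^ 2)).comp_hasFDerivAt x h1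
    refine h2.congr_fderiv ?_
    ext w
    rw [InnerProductSpace.toDual_apply_apply, real_inner_smul_left]
    simp
    ring
  have hder' : ∀ t, HasDerivAt z ((2 * h' (‖z t‖ ^ 2)) • J (z t)) t := by
    intro t
    have := hder t
    rwa [hgrad, proj_smul, hpr, map_smul] at this
  have hnorm : ∀ t, ‖z t‖ ^ 2 = ‖z 0‖ ^ 2 := by
    intro t
    have hd2 : ∀ t, HasDerivAt (fun t => ‖z t‖ ^ 2) 0 t := by
      intro t
      have := (hder' t).norm_sq
      rwa [real_inner_smul_right, inner_J hb hJ n _ (hpr t), mul_zero, mul_zero] at this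
    exact is_const_of_deriv_eq_zero (fun t => (hd2 t).differentiableAt) (fun t => (hd2 t).deriv) t 0
  set c : ℝ := 2 * h' (‖z 0‖ ^ 2) with hc
  have hder2 : ∀ t, HasDerivAt z (c • J (z t)) t := by
    intro t
    have := hder' t
    rwa [hnorm t] at this
  have hcpi : |c| < 2 * Real.pi := by
    rw [hc, abs_mul, abs_two]; linarith [hpi (‖z 0‖ ^ 2)]
  have hy : ∀ t, HasDerivAt (fun t => Real.cos (c * t) • z t - Real.sin (c * t) • J (z t)) 0 t := by
    intro t
    have hl : HasDerivAt (fun t : ℝ => c * t) c t := by simpa using (hasDerivAt_id t).const_mul c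
    have hJd : HasDerivAt (fun t => J (z t)) (J (c • J (z t))) t :=
      J.hasFDerivAt.comp_hasDerivAt t (hder2 t)
    have := (hl.cos.smul (hder2 t)).sub (hl.sin.smul hJd)
    refine this.congr_deriv ?_
    rw [map_smul, JJ hJ n _ (hpr t)]
    module
  have hyc : Real.cos (c * P) • z P - Real.sin (c * P) • J (z P) =
      Real.cos (c * 0) • z 0 - Real.sin (c * 0) • J (z 0) :=
    is_const_of_deriv_eq_zero (fun t => (hy t).differentiableAt) (fun t => (hy t).deriv) P 0
  have hzP : z P = z 0 := by simpa using hper 0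
  rw [hzP] at hyc
  have hin := congrArg (fun v => ⟪z 0, v⟫) hyc
  simp only [inner_sub_right, real_inner_smul_right, inner_J hb hJ n _ (hpr 0), mul_zero,
    Real.cos_zero, real_inner_self_eq_norm_sq, sub_zero, one_mul] at hin
  apply hne
  by_cases hz0 : ‖z 0‖ ^ 2 = 0
  · have : ∀ t, z t = 0 := by
      intro t
      have := hnorm t
      rw [hz0] at this
      simpa using this
    rw [this, this]
  · have hcos : Real.cos (c * P) = 1 := by
      have : (Real.cos (c * P) - 1) * ‖z 0‖ ^ 2 = 0 := by linarith
      rcases mul_eq_zero.1 this with h | h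
      · linarith
      · exact absurd h hz0
    have habs : |c * P| < 2 * Real.pi := by
      rw [abs_mul, abs_of_pos hP0]
      nlinarith [abs_nonneg c]
    have hc0 : c * P = 0 := (Real.cos_eq_one_iff_of_lt_of_lt (abs_lt.1 habs).1 (abs_lt.1 habs).2).1 hcos
    have hc1 : c = 0 := (mul_eq_zero.1 hc0).resolve_right hP0.ne'
    refine is_const_of_deriv_eq_zero (fun t => (hder2 t).differentiableAt) (fun t => ?_) t₁ t₂
    rw [(hder2 t).deriv, hc1, zero_smul]

theorem lower {b : ℕ × Bool → Z} {J : Z →L[ℝ] Z} (hb : IsHilbertBasis b) (hJ : IsJ b J)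
    {O : Set Z} (hO : IsOpen O) (r : ℝ) (hr : 0 < r) (hball : ball (0 : Z) r ⊆ O) {m' : ℝ}
    (hm' : m' ∈ capSet b J O) : Real.pi * r ^ 2 ≤ m' := by
  by_contra! hlt
  obtain ⟨m, hm1, hm2⟩ := exists_between hlt
  have hm0 : 0 < m := hm'.1.trans_lt hm1
  obtain ⟨δ, h, h', hδ, hδR, hs, hd, hpi, h0, hM, hbd⟩ := h_ex m (r ^ 2) hm0 hm2
  have hrs : Real.sqrt (r ^ 2 - δ) < r := by
    rw [Real.sqrt_lt' hr]; linarith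
  have hsub : ∀ z : Z, h (‖z‖ ^ 2) < m → ‖z‖ ≤ Real.sqrt (r ^ 2 - δ) := by
    intro z hz
    refine Real.le_sqrt_of_sq_le ?_
    by_contra hc
    exact absurd (hM _ (not_le.1 hc).le) hz.ne
  have hfr : ∀ z ∈ frontier O, r ≤ ‖z‖ := by
    intro z hz
    by_contra hc
    rw [hO.frontier_eq] at hz
    exact hz.2 (hball (by rw [mem_ball_zero_iff]; exact not_le.1 hc))
  have hadm : IsAdmissible O m (fun z : Z => h (‖z‖ ^ 2)) := by
    refine ⟨hm0, (hs.comp (contDiff_norm_sq ℝ)).contDiffOn, fun z _ => hbd _,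
      ⟨ball 0 (Real.sqrt δ), isOpen_ball, ⟨0, mem_ball_self (Real.sqrt_pos.2 hδ)⟩, ?_, ?_⟩,
      fun z hz => ?_, ?_, r - Real.sqrt (r ^ 2 - δ), by linarith, ?_⟩
    · refine (ball_subset_ball ?_).trans hball
      rw [Real.sqrt_le_left hr.le]; exact hδR.le
    · intro z hz
      rw [mem_ball_zero_iff, Real.lt_sqrt (norm_nonneg _)] at hz
      exact h0 _ hz.le
    · refine hM _ ?_
      have := hfr z hz
      nlinarith
    · refine isBounded_iff_forall_norm_le.2 ⟨Real.sqrt (r ^ 2 - δ), fun z hz => hsub z hz.2⟩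
    · intro x hx y hy
      have h1 := hsub x hx.2
      have h2 := hfr y hy
      have h3 := norm_sub_norm_le y x
      rw [dist_comm, dist_eq_norm]
      linarith
  obtain ⟨n₀, hn⟩ := hm'.2 m _ hm1 hadm
  obtain ⟨z, hz⟩ := hn n₀ le_rfl
  exact not_fast hb.1 hJ O h h' hd hpi n₀ z hz

end Lower
end Part10

section Final
variable {Z : Type*} [NormedAddCommGroup Z] [InnerProductSpace ℝ Z] [CompleteSpace Z]

def cj (b : ℕ × Bool → Z) (j : ℕ) (z : Z) : ℝ := ⟪b (j, true), z⟫ ^ 2 + ⟪b (j, false), z⟫ ^ 2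

lemma cj_nonneg (b : ℕ × Bool → Z) (j : ℕ) (z : Z) : 0 ≤ cj b j z := by unfold cj; positivity

lemma cj_cont (b : ℕ × Bool → Z) (j : ℕ) : Continuous (cj b j) := by unfold cj; fun_prop

lemma cj_sum {b : ℕ × Bool → Z} (hb : Orthonormal ℝ b) (n : ℕ) (z : Z) :
    ∑ j ∈ Finset.range n, cj b j z ≤ ‖z‖ ^ 2 := by
  have := hb.sum_inner_products_le z (s := Finset.range n ×ˢ Finset.univ)
  rw [Finset.sum_product] at this
  refine le_trans (le_of_eq ?_) this
  refine Finset.sum_congr rfl (fun j _ => ?_)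
  simp [cj]

lemma cj_le {b : ℕ × Bool → Z} (hb : Orthonormal ℝ b) (j : ℕ) (z : Z) : cj b j z ≤ ‖z‖ ^ 2 :=
  (Finset.single_le_sum (f := fun j => cj b j z) (fun i _ => cj_nonneg b i z)
    (Finset.self_mem_range_succ j)).trans (cj_sum hb (j + 1) z)

lemma cj_tsum {b : ℕ × Bool → Z} (hb : Orthonormal ℝ b) (z : Z) :
    ∑' j, ENNReal.ofReal (cj b j z) ≤ ENNReal.ofReal (‖z‖ ^ 2) := by
  refine ENNReal.tsum_le_of_sum_range_le (fun n => ?_)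
  rw [← ENNReal.ofReal_sum_of_nonneg (fun i _ => cj_nonneg b i z)]
  exact ENNReal.ofReal_le_ofReal (cj_sum hb n z)

lemma cj_split (b : ℕ × Bool → Z) (j : ℕ) (z y : Z) (ε : ℝ) (hε : 0 < ε) :
    cj b j y ≤ (1 + ε) * cj b j z + (1 + 1 / ε) * cj b j (y - z) := by
  have key : ∀ a c : ℝ, c ^ 2 ≤ (1 + ε) * a ^ 2 + (1 + 1 / ε) * (c - a) ^ 2 := by
    intro a c
    have h : 0 ≤ (ε * a - (c - a)) ^ 2 / ε := by positivity
    have e : (1 + ε) * a ^ 2 + (1 + 1 / ε) * (c - a) ^ 2 - c ^ 2 = (ε * a - (c - a)) ^ 2 / ε := by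
      field_simp; ring
    linarith
  simp only [cj, inner_sub_right]
  have h1 := key ⟪b (j, true), z⟫ ⟪b (j, true), y⟫
  have h2 := key ⟪b (j, false), z⟫ ⟪b (j, false), y⟫
  linarith

lemma open_E {b : ℕ × Bool → Z} (hb : Orthonormal ℝ b) (r : ℕ → ℝ≥0∞) (ρ : ℝ) (hρ : 0 < ρ)
    (hr : ∀ j, ENNReal.ofReal ρ ≤ r j) :
    IsOpen {z : Z | ∑' j, ENNReal.ofReal (cj b j z) / (r j) ^ 2 < 1} ∧
      ball (0 : Z) ρ ⊆ {z : Z | ∑' j, ENNReal.ofReal (cj b j z) / (r j) ^ 2 < 1} := by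
  have hS : ∀ z : Z, ∑' j, ENNReal.ofReal (cj b j z) / (r j) ^ 2 ≤
      ENNReal.ofReal (‖z‖ ^ 2 / ρ ^ 2) := by
    intro z
    calc ∑' j, ENNReal.ofReal (cj b j z) / (r j) ^ 2 
        ≤ ∑' j, ENNReal.ofReal (cj b j z) / (ENNReal.ofReal ρ) ^ 2 := by
          refine ENNReal.tsum_le_tsum (fun j => ?_)
          exact ENNReal.div_le_div_left (pow_le_pow_left' (hr j) 2) _
      _ = (∑' j, ENNReal.ofReal (cj b j z)) / (ENNReal.ofReal ρ) ^ 2 := by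
          simp only [div_eq_mul_inv, ENNReal.tsum_mul_right]
      _ ≤ ENNReal.ofReal (‖z‖ ^ 2) / (ENNReal.ofReal ρ) ^ 2 :=
          ENNReal.div_le_div_right (cj_tsum hb z) _
      _ = ENNReal.ofReal (‖z‖ ^ 2 / ρ ^ 2) := by
          rw [ENNReal.ofReal_div_of_pos (by positivity), ENNReal.ofReal_pow hρ.le]
  refine ⟨?_, ?_⟩
  · rw [isOpen_iff_mem_nhds]
    intro z hz
    rw [Set.mem_setOf_eq] at hz
    set A := ∑' j, ENNReal.ofReal (cj b j z) / (r j) ^ 2 with hA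
    have hAtop : A ≠ ⊤ := (hz.trans ENNReal.one_lt_top).ne
    set s := A.toReal with hs
    have hAs : A = ENNReal.ofReal s := (ENNReal.ofReal_toReal hAtop).symm
    have hs1 : s < 1 := by
      rw [hAs, ← ENNReal.ofReal_one, ENNReal.ofReal_lt_ofReal_iff one_pos] at hz
      exact hz
    have hs0 : 0 ≤ s := ENNReal.toReal_nonneg
    set ε := (1 - s) / 2 with hε
    have hε0 : 0 < ε := by rw [hε]; linarith
    have hval : (1 + ε) * s + (1 + 1 / ε) * (‖z - z‖ ^ 2 / ρ ^ 2) < 1 := by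
      simp only [sub_self, norm_zero]
      rw [hε]; ring_nf; nlinarith
    have hcont : Continuous (fun y : Z => (1 + ε) * s + (1 + 1 / ε) * (‖y - z‖ ^ 2 / ρ ^ 2)) := by
      fun_prop
    filter_upwards [hcont.continuousAt.eventually_lt continuousAt_const hval] with y hy
    calc ∑' j, ENNReal.ofReal (cj b j y) / (r j) ^ 2
        ≤ ∑' j, (ENNReal.ofReal (1 + ε) * (ENNReal.ofReal (cj b j z) / (r j) ^ 2) +
            ENNReal.ofReal (1 + 1 / ε) * (ENNReal.ofReal (cj b j (y - z)) / (r j) ^ 2)) := by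
          refine ENNReal.tsum_le_tsum (fun j => ?_)
          rw [← mul_div_assoc, ← mul_div_assoc, ← ENNReal.add_div, ← ENNReal.ofReal_mul (by positivity),
            ← ENNReal.ofReal_mul (by positivity), ← ENNReal.ofReal_add
              (mul_nonneg (by positivity) (cj_nonneg _ _ _))
              (mul_nonneg (by positivity) (cj_nonneg _ _ _))]
          exact ENNReal.div_le_div_right (ENNReal.ofReal_le_ofReal (cj_split b j z y ε hε0)) _
      _ = ENNReal.ofReal (1 + ε) * A + ENNReal.ofReal (1 + 1 / ε) *
            ∑' j, (ENNReal.ofReal (cj b j (y - z)) / (r j) ^ 2) := by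
          rw [ENNReal.tsum_add, ENNReal.tsum_mul_left, ENNReal.tsum_mul_left]
      _ ≤ ENNReal.ofReal (1 + ε) * ENNReal.ofReal s + ENNReal.ofReal (1 + 1 / ε) *
            ENNReal.ofReal (‖y - z‖ ^ 2 / ρ ^ 2) := by
          rw [← hAs]; gcongr; exact hS _
      _ = ENNReal.ofReal ((1 + ε) * s + (1 + 1 / ε) * (‖y - z‖ ^ 2 / ρ ^ 2)) := by
          rw [← ENNReal.ofReal_mul (by positivity), ← ENNReal.ofReal_mul (by positivity),
            ← ENNReal.ofReal_add (by positivity) (by positivity)]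
      _ < 1 := by
          rw [← ENNReal.ofReal_one, ENNReal.ofReal_lt_ofReal_iff one_pos]
          exact hy
  · intro z hz
    rw [mem_ball_zero_iff] at hz
    refine (hS z).trans_lt ?_
    rw [← ENNReal.ofReal_one, ENNReal.ofReal_lt_ofReal_iff one_pos, div_lt_one (by positivity)]
    nlinarith [norm_nonneg z]

lemma E_sub_D (b : ℕ × Bool → Z) (r : ℕ → ℝ≥0∞) (hr : ∀ j, 0 < r j) (z : Z)
    (hz : ∑' j, ENNReal.ofReal (cj b j z) / (r j) ^ 2 < 1) (j : ℕ) :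
    ENNReal.ofReal (cj b j z) < (r j) ^ 2 := by
  by_contra! hc
  have h1 : ENNReal.ofReal (cj b j z) / (r j) ^ 2 < 1 := (ENNReal.le_tsum j).trans_lt hz
  have h0 : (r j) ^ 2 ≠ 0 := pow_ne_zero _ (hr j).ne'
  have ht : (r j) ^ 2 ≠ ⊤ := (hc.trans_lt ENNReal.ofReal_lt_top).ne
  have : 1 ≤ ENNReal.ofReal (cj b j z) / (r j) ^ 2 := by
    rw [ENNReal.le_div_iff_mul_le (Or.inl h0) (Or.inl ht), one_mul]; exact hc
  exact absurd h1 (not_lt.2 this)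

lemma open_D {b : ℕ × Bool → Z} (hb : Orthonormal ℝ b) (r : ℕ → ℝ≥0∞) (ρ : ℝ) (hρ : 0 < ρ)
    (hr : ∀ j, ENNReal.ofReal ρ ≤ r j) :
    IsOpen {z : Z | ∀ j, ENNReal.ofReal (cj b j z) < (r j) ^ 2} := by
  rw [isOpen_iff_mem_nhds]
  intro z hz
  have hlim := ENNReal.tendsto_atTop_zero_of_tsum_ne_top
    ((cj_tsum hb z).trans_lt ENNReal.ofReal_lt_top).ne
  have hpos : (0 : ℝ≥0∞) < ENNReal.ofReal (ρ ^ 2 / 4) := ENNReal.ofReal_pos.2 (by positivity)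
  obtain ⟨N, hN⟩ := Filter.eventually_atTop.1 (hlim.eventually_lt_const hpos)
  have h1 : ∀ᶠ y in nhds z, ∀ j ∈ Finset.range N, ENNReal.ofReal (cj b j y) < (r j) ^ 2 := by
    rw [Filter.eventually_all_finset]
    intro j _
    have hc : Continuous (fun y => ENNReal.ofReal (cj b j y)) :=
      ENNReal.continuous_ofReal.comp (cj_cont b j)
    exact hc.continuousAt.eventually_lt continuousAt_const (hz j)
  filter_upwards [h1, ball_mem_nhds z (half_pos hρ)] with y hy hyb
  intro j
  by_cases hj : j < N
  · exact hy j (Finset.mem_range.2 hj)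
  · have h2 := hN j (not_lt.1 hj)
    rw [ENNReal.ofReal_lt_ofReal_iff (by positivity)] at h2
    have h3 := cj_split b j z y 1 one_pos
    have h4 := cj_le hb j (y - z)
    rw [mem_ball, dist_eq_norm] at hyb
    have h5 : ‖y - z‖ ^ 2 < (ρ / 2) ^ 2 := by
      have := norm_nonneg (y - z)
      nlinarith
    have h6 : cj b j y < ρ ^ 2 := by nlinarith
    calc ENNReal.ofReal (cj b j y) < ENNReal.ofReal (ρ ^ 2) := by
          rw [ENNReal.ofReal_lt_ofReal_iff (by positivity)]; exact h6
      _ = ENNReal.ofReal ρ ^ 2 := ENNReal.ofReal_pow hρ.le 2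
      _ ≤ (r j) ^ 2 := pow_le_pow_left' (hr j) 2

lemma cap_eq {b : ℕ × Bool → Z} {J : Z →L[ℝ] Z} (hb : IsHilbertBasis b) (hJ : IsJ b J)
    (r : ℕ → ℝ≥0∞) (ρ : ℝ) (hρ : 0 < ρ) (hinf : ENNReal.ofReal ρ = ⨅ j, r j)
    {O : Set Z} (hO : IsOpen O) (hball : ball (0 : Z) ρ ⊆ O)
    (hsub : ∀ z ∈ O, ∀ j, ENNReal.ofReal (cj b j z) < (r j) ^ 2) :
    cap b J O = ENNReal.ofReal Real.pi * (⨅ j, r j) ^ 2 := by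
  have hpi := Real.pi_pos
  have hmem : Real.pi * ρ ^ 2 ∈ capSet b J O := by
    refine ⟨by positivity, fun m f hm hf => ?_⟩
    have h1 : ρ ^ 2 < m / Real.pi := by rw [lt_div_iff₀ hpi]; linarith
    obtain ⟨a0, ha1, ha2⟩ := exists_between h1
    have ha0 : 0 ≤ a0 := (sq_nonneg ρ).trans ha1.le
    have h2 : (⨅ j, r j) < ENNReal.ofReal (Real.sqrt a0) := by
      rw [← hinf, ENNReal.ofReal_lt_ofReal_iff']
      have := Real.lt_sqrt_of_sq_lt ha1
      exact ⟨this, hρ.trans this⟩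
    obtain ⟨j0, hj0⟩ := iInf_lt_iff.1 h2
    refine upper hb hJ hO j0 a0 ha0 (fun z hz => ?_) ?_ hf
    · have h3 := (hsub z hz j0).le.trans (pow_le_pow_left' hj0.le 2)
      rw [← ENNReal.ofReal_pow (Real.sqrt_nonneg _), Real.sq_sqrt ha0,
        ENNReal.ofReal_le_ofReal_iff ha0] at h3
      exact h3
    · rw [lt_div_iff₀ hpi] at ha2; linarith
  have hval : ENNReal.ofReal Real.pi * (⨅ j, r j) ^ 2 = ENNReal.ofReal (Real.pi * ρ ^ 2) := by
    rw [← hinf, ENNReal.ofReal_mul hpi.le, ENNReal.ofReal_pow hρ.le]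
  rw [hval]
  refine le_antisymm (sInf_le ⟨_, hmem, rfl⟩) (le_sInf ?_)
  rintro _ ⟨m', hm', rfl⟩
  exact ENNReal.ofReal_le_ofReal (lower hb hJ hO ρ hρ hball hm')

end Final

/-- For a sequence `r = (r_j)` with `r_j ∈ (0, ∞]` and
`0 < inf_j r_j < ∞`, the capacities of the "polydisc"
`D(r) = {z : p_j² + q_j² < r_j² for all j}` and of the ellipsoid
`E(r) = {z : Σ_j (p_j² + q_j²)/r_j² < 1}` are both `π (inf_j r_j)²`.
Here `p_j z = ⟪φ_j^+, z⟫` and `q_j z = ⟪φ_j^-, z⟫` are the symplectic coordinates. -/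
theorem cap_ellipsoid_and_polydisc
    {Z : Type*} [NormedAddCommGroup Z] [InnerProductSpace ℝ Z] [CompleteSpace Z]
    (b : ℕ × Bool → Z) (J : Z →L[ℝ] Z) (hb : IsHilbertBasis b) (hJ : IsJ b J)
    (r : ℕ → ℝ≥0∞) (hrpos : ∀ j : ℕ, 0 < r j)
    (hinfpos : 0 < ⨅ j : ℕ, r j) (hinffin : (⨅ j : ℕ, r j) < ⊤) :
    cap b J {z : Z | ∑' j : ℕ,
        ENNReal.ofReal (⟪b (j, true), z⟫ ^ 2 + ⟪b (j, false), z⟫ ^ 2) / (r j) ^ 2 < 1}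
      = ENNReal.ofReal Real.pi * (⨅ j : ℕ, r j) ^ 2 ∧
    cap b J {z : Z | ∀ j : ℕ,
        ENNReal.ofReal (⟪b (j, true), z⟫ ^ 2 + ⟪b (j, false), z⟫ ^ 2) < (r j) ^ 2}
      = ENNReal.ofReal Real.pi * (⨅ j : ℕ, r j) ^ 2 := by
  set ρ : ℝ := (⨅ j : ℕ, r j).toReal with hρdef
  have hρ : 0 < ρ := ENNReal.toReal_pos hinfpos.ne' hinffin.ne
  have hinf : ENNReal.ofReal ρ = ⨅ j, r j := ENNReal.ofReal_toReal hinffin.ne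
  have hr : ∀ j, ENNReal.ofReal ρ ≤ r j := fun j => hinf.le.trans (iInf_le r j)
  obtain ⟨hE, hB⟩ := open_E hb.1 r ρ hρ hr
  have hD := open_D hb.1 r ρ hρ hr
  exact ⟨cap_eq hb hJ r ρ hρ hinf hE hB (fun z hz j => E_sub_D b r hrpos z hz j),
    cap_eq hb hJ r ρ hρ hinf hD (fun z hz j => E_sub_D b r hrpos z (hB hz) j)
      (fun z hz j => hz j)⟩

end Kuksin
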